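/- arXiv:1806.02561 — 2 statements merged into one kernel-verified Lean document; each statement's English description precedes it below -/
import Mathlib

section
/- Let 1 ≤ p ≤ ∞, let β̄ = (β_k) be any real sequence, and let (r_n) be a sequence of reals with r_n > 1 and r_n/n → ∞ as n → ∞. Then n^{r_n} Ẽ_n(W^{r_n}_{β̄,1})_{L_p} → (2^{1−1/p}/π^{1+1/p}) ‖cos t‖_p^2 as n → ∞. -/
open MeasureTheory Real Set
open scoped ENNReal

/-- The `L_p` "norm" of a (2π-periodic) function over one period `(0, 2π]`. -/
noncomputable def LpNormPer (p : ℝ≥0∞) (f : ℝ → ℝ) : ℝ :=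
  (eLpNorm f p (volume.restrict (Ioc (0:ℝ) (2*π)))).toReal

/-- `‖cos t‖_p` over one period. -/
noncomputable def cosLp (p : ℝ≥0∞) : ℝ := LpNormPer p Real.cos

/-- `T` is a trigonometric polynomial of order (degree) at most `m`. -/
def IsTrigPolyDeg (m : ℕ) (T : ℝ → ℝ) : Prop :=
  ∃ a b : ℕ → ℝ, ∀ x : ℝ, T x = a 0 / 2 +
    ∑ k ∈ Finset.Icc 1 m, (a k * Real.cos (k * x) + b k * Real.sin (k * x))

/-- Admissible `φ`: 2π-periodic, integrable on a period, `φ ⊥ 1`, `‖φ‖₁ ≤ 1`. -/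
def AdmPhi (φ : ℝ → ℝ) : Prop :=
  (∀ t : ℝ, φ (t + 2*π) = φ t) ∧ IntegrableOn φ (Ioc (0:ℝ) (2*π)) volume ∧
  (∫ t in (0:ℝ)..(2*π), φ t) = 0 ∧ (∫ t in (0:ℝ)..(2*π), |φ t|) ≤ 1

/-- The generating kernel `Ψ_β̄(t) = Σ_{k≥1} ψ(k) cos(kt − πβ_k/2)`. -/
noncomputable def ker1 (ψ βb : ℕ → ℝ) (t : ℝ) : ℝ :=
  ∑' k : ℕ, ψ (k+1) * Real.cos ((k+1 : ℝ) * t - π * βb (k+1) / 2)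

/-- The class `C^ψ_{β̄,1}` of convolutions `f = a₀/2 + (1/π) Ψ_β̄ * φ`. -/
def ClassC (ψ βb : ℕ → ℝ) : Set (ℝ → ℝ) :=
  { f | ∃ a₀ : ℝ, ∃ φ : ℝ → ℝ, AdmPhi φ ∧
      ∀ x : ℝ, f x = a₀ / 2 + (1/π) * ∫ t in (0:ℝ)..(2*π), ker1 ψ βb (x - t) * φ t }

/-- `T` is the interpolation trigonometric polynomial `S̃_{n-1}(f)` of `f` at the
equidistant nodes `x_k^{(n-1)} = 2kπ/(2n-1)`. -/
def InterpolatesAt (n : ℕ) (T f : ℝ → ℝ) : Prop :=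
  IsTrigPolyDeg (n - 1) T ∧
  ∀ k : ℤ, T (2 * (k:ℝ) * π / (2 * (n:ℝ) - 1)) = f (2 * (k:ℝ) * π / (2 * (n:ℝ) - 1))

/-- `Ẽ_n(F)_{L_p} = sup_{f ∈ F} ‖f − S̃_{n-1}(f;·)‖_p`. -/
noncomputable def interpErr (p : ℝ≥0∞) (n : ℕ) (F : Set (ℝ → ℝ)) : ℝ :=
  sSup { e : ℝ | ∃ f ∈ F, ∃ T : ℝ → ℝ, InterpolatesAt n T f ∧
    e = LpNormPer p (fun x => f x - T x) }

lemma trig_unique (m : ℕ) (T : ℝ → ℝ) (hT : IsTrigPolyDeg m T)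
    (h0 : ∀ k : ℤ, T (2 * (k:ℝ) * π / (2 * (m:ℝ) + 1)) = 0) : ∀ x, T x = 0 := by
  obtain ⟨a, b, hab⟩ := hT
  let P : Polynomial ℂ := Polynomial.C ((a 0 : ℂ)/2) * Polynomial.X ^ m +
    ∑ k ∈ Finset.Icc 1 m, (Polynomial.C (((a k : ℂ) - Complex.I * b k)/2) * Polynomial.X ^ (m+k) +
      Polynomial.C (((a k : ℂ) + Complex.I * b k)/2) * Polynomial.X ^ (m-k))
  have hP : ∀ x : ℝ, P.eval (Complex.exp (x * Complex.I)) =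
      (T x : ℂ) * (Complex.exp (x * Complex.I))^m := by
    intro x
    have hz : Complex.exp (x * Complex.I) ≠ 0 := Complex.exp_ne_zero _
    simp only [P, Polynomial.eval_add, Polynomial.eval_mul, Polynomial.eval_C, Polynomial.eval_pow,
      Polynomial.eval_X, Polynomial.eval_finsetSum, hab x]
    push_cast
    rw [add_mul, Finset.sum_mul]
    congr 1
    apply Finset.sum_congr rfl
    intro k hk
    have hkm : k ≤ m := (Finset.mem_Icc.mp hk).2
    have e1 : Complex.exp (x * Complex.I) ^ k =
        Complex.cos (k * x) + Complex.sin (k*x) * Complex.I := by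
      rw [← Complex.exp_nat_mul, ← Complex.exp_mul_I]; ring_nf
    have e2 : Complex.exp (x * Complex.I) ^ m = Complex.exp (x * Complex.I) ^ (m-k) *
        Complex.exp (x * Complex.I) ^ k := by
      rw [← pow_add]; congr 1; omega
    have e3 : (Complex.cos (k * x))^2 + (Complex.sin (k*x))^2 = 1 := by
      rw [add_comm]; exact Complex.sin_sq_add_cos_sq _
    rw [pow_add, e2, e1]
    linear_combination (-Complex.exp (x * Complex.I) ^ (m-k) *
      ((a k : ℂ) + Complex.I * b k)/2) * e3 + (Complex.exp (x * Complex.I) ^ (m-k)) * (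
      ((a k:ℂ)/2 * Complex.sin (k*x)^2 - b k * Complex.cos (k*x) * Complex.sin (k*x) 
       - Complex.I * b k * Complex.sin (k*x)^2 / 2 ) * Complex.I_sq)
  have hP0 : P = 0 := by
    have hN : (2*m+1) ≠ 0 := by omega
    have hprim := Complex.isPrimitiveRoot_exp (2*m+1) hN
    apply Polynomial.eq_zero_of_natDegree_lt_card_of_eval_eq_zero P
      (f := fun i : Fin (2*m+1) => Complex.exp (2 * ↑Real.pi * Complex.I / ((2*m+1 : ℕ):ℂ)) ^ (i:ℕ))
    · intro i j hij
      exact Fin.ext (hprim.pow_inj i.2 j.2 hij)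
    · intro i
      have : Complex.exp (2 * ↑Real.pi * Complex.I / ((2*m+1 : ℕ):ℂ)) ^ (i:ℕ) =
          Complex.exp (((2 * (((i:ℕ):ℤ):ℝ) * π / (2 * (m:ℝ) + 1) : ℝ) : ℂ) * Complex.I) := by
        rw [← Complex.exp_nat_mul]
        congr 1
        push_cast
        ring
      rw [this, hP, h0]
      simp
    · simp only [Fintype.card_fin]
      apply Nat.lt_succ_of_le
      apply Polynomial.natDegree_add_le_of_degree_le
      · exact (Polynomial.natDegree_C_mul_X_pow_le _ _).trans (by omega)
      · apply Polynomial.natDegree_sum_le_of_forall_le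
        intro k hk
        have hkm : k ≤ m := (Finset.mem_Icc.mp hk).2
        apply Polynomial.natDegree_add_le_of_degree_le
        · exact (Polynomial.natDegree_C_mul_X_pow_le _ _).trans (by omega)
        · exact (Polynomial.natDegree_C_mul_X_pow_le _ _).trans (by omega)
  intro x
  have := hP x
  rw [hP0, Polynomial.eval_zero] at this
  have h2 : (T x : ℂ) = 0 := by
    rcases mul_eq_zero.mp this.symm with h | h
    · exact h
    · exact absurd h (pow_ne_zero _ (Complex.exp_ne_zero _))
  exact_mod_cast h2

lemma interp_unique (n : ℕ) (hn : 1 ≤ n) (T S f : ℝ → ℝ) (hT : InterpolatesAt n T f)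
    (hS : InterpolatesAt n S f) : T = S := by
  obtain ⟨⟨a, b, hab⟩, h1⟩ := hT
  obtain ⟨⟨a', b', hab'⟩, h2⟩ := hS
  funext x
  have : (fun x => T x - S x) x = 0 := by
    apply trig_unique (n-1) (fun x => T x - S x)
    · refine ⟨fun k => a k - a' k, fun k => b k - b' k, fun x => ?_⟩
      simp only [hab, hab', Finset.sum_add_distrib, sub_mul, Finset.sum_sub_distrib]
      ring
    · intro k
      have e : (2 * ((n-1:ℕ):ℝ) + 1) = 2 * (n:ℝ) - 1 := by
        rw [Nat.cast_sub hn]; push_cast; ring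
      rw [e]
      simp only [h1, h2, sub_self]
  simpa [sub_eq_zero] using this

/-- Folded frequency modulo `2n-1`. -/
def foldJ (n K : ℕ) : ℕ := if K % (2*n-1) < n then K % (2*n-1) else (2*n-1) - K % (2*n-1)

/-- Sign of the folded sine. -/
noncomputable def foldS (n K : ℕ) : ℝ := if K % (2*n-1) < n then 1 else -1

lemma foldJ_lt (n K : ℕ) (hn : 1 ≤ n) : foldJ n K < n := by
  unfold foldJ
  have := Nat.mod_lt K (show 2*n-1 > 0 by omega)
  split_ifs <;> omega

lemma abs_foldS (n K : ℕ) : |foldS n K| = 1 := by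
  unfold foldS; split_ifs <;> simp

lemma fold_node (n K : ℕ) (hn : 1 ≤ n) (i : ℤ) :
    Real.cos (foldJ n K * (2 * (i:ℝ) * π / (2 * (n:ℝ) - 1))) =
      Real.cos (K * (2 * (i:ℝ) * π / (2 * (n:ℝ) - 1))) ∧
    foldS n K * Real.sin (foldJ n K * (2 * (i:ℝ) * π / (2 * (n:ℝ) - 1))) =
      Real.sin (K * (2 * (i:ℝ) * π / (2 * (n:ℝ) - 1))) := by
  have hlt := Nat.mod_lt K (show 2*n-1 > 0 by omega)
  have hdiv := Nat.div_add_mod K (2*n-1)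
  set ρ := K % (2*n-1) with hρ
  set q := K / (2*n-1) with hq
  have hNpos : (2 * (n:ℝ) - 1) ≠ 0 := by
    have : (1:ℝ) ≤ n := by exact_mod_cast hn
    linarith
  have hNc : ((2*n-1 : ℕ) : ℝ) = 2 * (n:ℝ) - 1 := by
    rw [Nat.cast_sub (by omega)]; push_cast; ring
  have hK : (K:ℝ) = (2 * (n:ℝ) - 1) * q + ρ := by
    rw [← hNc]; exact_mod_cast hdiv.symm
  set x := 2 * (i:ℝ) * π / (2 * (n:ℝ) - 1) with hx
  have hNx : (2 * (n:ℝ) - 1) * x = i * (2*π) := by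
    rw [hx]; field_simp
  have hKx : (K:ℝ) * x = ρ * x + ((q * i : ℤ) : ℝ) * (2*π) := by
    rw [hK]; push_cast; linear_combination (q:ℝ) * hNx
  rw [hKx, Real.cos_add_int_mul_two_pi, Real.sin_add_int_mul_two_pi]
  unfold foldJ foldS
  rw [← hρ]
  split_ifs with h
  · simp
  · have e : (((2*n-1) - ρ : ℕ) : ℝ) * x = -(ρ * x) + (i:ℝ) * (2*π) := by
      rw [Nat.cast_sub hlt.le, hNc]; linear_combination hNx
    rw [e, Real.cos_add_int_mul_two_pi, Real.sin_add_int_mul_two_pi]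
    simp

lemma foldJ_of_lt (n K : ℕ) (h : K < n) : foldJ n K = K ∧ foldS n K = 1 := by
  have : K % (2*n-1) = K := Nat.mod_eq_of_lt (by omega)
  simp [foldJ, foldS, this, h]

lemma foldJ_self (n : ℕ) (h : 2 ≤ n) : foldJ n n = n - 1 ∧ foldS n n = -1 := by
  have : n % (2*n-1) = n := Nat.mod_eq_of_lt (by omega)
  simp [foldJ, foldS, this]
  omega

/-- abstract trig series -/
noncomputable def tser (a₀ r : ℝ) (u v : ℕ → ℝ) (x : ℝ) : ℝ :=
  a₀ / 2 + ∑' k : ℕ, ((k+1 : ℕ):ℝ) ^ (-r) *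
    (u k * Real.cos (((k+1 : ℕ):ℝ) * x) + v k * Real.sin (((k+1 : ℕ):ℝ) * x))

noncomputable def tint (n : ℕ) (a₀ r : ℝ) (u v : ℕ → ℝ) (x : ℝ) : ℝ :=
  a₀ / 2 + ∑' k : ℕ, ((k+1 : ℕ):ℝ) ^ (-r) *
    (u k * Real.cos (foldJ n (k+1) * x) + v k * (foldS n (k+1) * Real.sin (foldJ n (k+1) * x)))

lemma summ_psi (r : ℝ) (hr : 1 < r) : Summable (fun k : ℕ => ((k+1 : ℕ):ℝ) ^ (-r)) := by
  have := (Real.summable_nat_rpow (p := -r)).mpr (by linarith)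
  exact (summable_nat_add_iff 1).mpr this

lemma term_bound (c u v a b : ℝ) (hc : 0 ≤ c) (hu : |u| ≤ 1) (hv : |v| ≤ 1) (ha : |a| ≤ 1)
    (hb : |b| ≤ 1) : |c * (u * a + v * b)| ≤ c * 2 := by
  rw [abs_mul, abs_of_nonneg hc]
  apply mul_le_mul_of_nonneg_left _ hc
  calc |u * a + v * b| ≤ |u * a| + |v * b| := abs_add_le _ _
    _ = |u| * |a| + |v| * |b| := by rw [abs_mul, abs_mul]
    _ ≤ 1 * 1 + 1 * 1 := by gcongr
    _ = 2 := by norm_num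

lemma psi_nonneg (r : ℝ) (k : ℕ) : 0 ≤ ((k+1 : ℕ):ℝ) ^ (-r) := by positivity

lemma ser_bound1 (r : ℝ) (u v : ℕ → ℝ) (hu : ∀ k, |u k| ≤ 1)
    (hv : ∀ k, |v k| ≤ 1) (x : ℝ) (k : ℕ) : ‖((k+1 : ℕ):ℝ) ^ (-r) *
    (u k * Real.cos (((k+1 : ℕ):ℝ) * x) + v k * Real.sin (((k+1 : ℕ):ℝ) * x))‖ ≤
      ((k+1 : ℕ):ℝ) ^ (-r) * 2 :=
  term_bound _ _ _ _ _ (psi_nonneg r k) (hu k) (hv k) (abs_cos_le_one _) (abs_sin_le_one _)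

lemma ser_bound2 (n : ℕ) (r : ℝ) (u v : ℕ → ℝ) (hu : ∀ k, |u k| ≤ 1)
    (hv : ∀ k, |v k| ≤ 1) (x : ℝ) (k : ℕ) : ‖((k+1 : ℕ):ℝ) ^ (-r) *
    (u k * Real.cos (foldJ n (k+1) * x) + v k * (foldS n (k+1) * Real.sin (foldJ n (k+1) * x)))‖ ≤
      ((k+1 : ℕ):ℝ) ^ (-r) * 2 :=
  term_bound _ _ _ _ _ (psi_nonneg r k) (hu k) (hv k) (abs_cos_le_one _)
    (by rw [abs_mul, abs_foldS, one_mul]; exact abs_sin_le_one _)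

lemma tser_cont (a₀ r : ℝ) (hr : 1 < r) (u v : ℕ → ℝ) (hu : ∀ k, |u k| ≤ 1)
    (hv : ∀ k, |v k| ≤ 1) : Continuous (tser a₀ r u v) := by
  unfold tser
  refine continuous_const.add (continuous_tsum (u := fun k => ((k+1 : ℕ):ℝ) ^ (-r) * 2) ?_
    ((summ_psi r hr).mul_right 2) ?_)
  · intro k; fun_prop
  · intro k x; exact ser_bound1 r u v hu hv x k

lemma tint_cont (n : ℕ) (a₀ r : ℝ) (hr : 1 < r) (u v : ℕ → ℝ) (hu : ∀ k, |u k| ≤ 1)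
    (hv : ∀ k, |v k| ≤ 1) : Continuous (tint n a₀ r u v) := by
  unfold tint
  refine continuous_const.add (continuous_tsum (u := fun k => ((k+1 : ℕ):ℝ) ^ (-r) * 2) ?_
    ((summ_psi r hr).mul_right 2) ?_)
  · intro k; fun_prop
  · intro k x; exact ser_bound2 n r u v hu hv x k

lemma tint_interp (n : ℕ) (hn : 1 ≤ n) (a₀ r : ℝ) (hr : 1 < r) (u v : ℕ → ℝ)
    (hu : ∀ k, |u k| ≤ 1) (hv : ∀ k, |v k| ≤ 1) :
    InterpolatesAt n (tint n a₀ r u v) (tser a₀ r u v) := by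
  refine ⟨?_, ?_⟩
  · let A : ℕ → ℝ := fun j => ∑' k : ℕ, if foldJ n (k+1) = j then ((k+1 : ℕ):ℝ) ^ (-r) * u k else 0
    let B : ℕ → ℝ := fun j => ∑' k : ℕ, if foldJ n (k+1) = j then
      ((k+1 : ℕ):ℝ) ^ (-r) * (v k * foldS n (k+1)) else 0
    have sA : ∀ j, Summable (fun k : ℕ => if foldJ n (k+1) = j then ((k+1 : ℕ):ℝ) ^ (-r) * u k else 0) := by
      intro j
      apply Summable.of_norm_bounded (summ_psi r hr)
      intro k
      have := psi_nonneg r k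
      split_ifs
      · rw [Real.norm_eq_abs, abs_mul, abs_of_nonneg this]
        exact mul_le_of_le_one_right this (hu k)
      · simpa using this
    have sB : ∀ j, Summable (fun k : ℕ => if foldJ n (k+1) = j then
      ((k+1 : ℕ):ℝ) ^ (-r) * (v k * foldS n (k+1)) else 0) := by
      intro j
      apply Summable.of_norm_bounded (summ_psi r hr)
      intro k
      have := psi_nonneg r k
      split_ifs
      · rw [Real.norm_eq_abs, abs_mul, abs_of_nonneg this, abs_mul, abs_foldS, mul_one]
        exact mul_le_of_le_one_right this (hv k)
      · simpa using this
    refine ⟨fun j => if j = 0 then a₀ + 2 * A 0 else A j, B, fun x => ?_⟩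
    have key : ∑' k : ℕ, ((k+1 : ℕ):ℝ) ^ (-r) *
        (u k * Real.cos (foldJ n (k+1) * x) +
          v k * (foldS n (k+1) * Real.sin (foldJ n (k+1) * x))) =
        ∑ j ∈ Finset.range n, (A j * Real.cos (j * x) + B j * Real.sin (j*x)) := by
      have h1 : ∀ j : ℕ, A j * Real.cos (j * x) + B j * Real.sin (j*x) =
          ∑' k : ℕ, ((if foldJ n (k+1) = j then ((k+1 : ℕ):ℝ) ^ (-r) * u k else 0) * Real.cos (j*x) +
          (if foldJ n (k+1) = j then
            ((k+1 : ℕ):ℝ) ^ (-r) * (v k * foldS n (k+1)) else 0) * Real.sin (j * x)) := by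
        intro j
        rw [Summable.tsum_add ((sA j).mul_right _) ((sB j).mul_right _), tsum_mul_right, tsum_mul_right]
      rw [Finset.sum_congr rfl (fun j _ => h1 j), ← Summable.tsum_finsetSum]
      · apply tsum_congr
        intro k
        rw [Finset.sum_eq_single (foldJ n (k+1))]
        · simp only [if_true]; ring
        · intro j _ hj
          simp [Ne.symm hj]
        · intro h
          exact absurd (Finset.mem_range.mpr (foldJ_lt n (k+1) hn)) h
      · intro j _
        exact ((sA j).mul_right _).add ((sB j).mul_right _)
    unfold tint
    rw [key]
    obtain ⟨m, rfl⟩ : ∃ m, n = m + 1 := ⟨n-1, by omega⟩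
    rw [Finset.sum_range_succ', Nat.add_sub_cancel, Finset.range_eq_Ico,
      Finset.sum_Ico_add' (fun j : ℕ => A j * Real.cos (j * x) + B j * Real.sin (j*x)) 0 m 1]
    have e : Finset.Ico (0+1) (m+1) = Finset.Icc 1 m := by ext; simp
    rw [e]
    have e2 : ∑ k ∈ Finset.Icc 1 m, ((if k = 0 then a₀ + 2 * A 0 else A k) * Real.cos (k * x) + B k * Real.sin (k * x))
       = ∑ k ∈ Finset.Icc 1 m, (A k * Real.cos (k * x) + B k * Real.sin (k * x)) := by
      apply Finset.sum_congr rfl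
      intro k hk
      have : k ≠ 0 := by have := (Finset.mem_Icc.mp hk).1; omega
      simp [this]
    rw [e2]
    simp
    ring
  · intro i
    unfold tint tser
    congr 1
    apply tsum_congr
    intro k
    rw [(fold_node n (k+1) hn i).1, (fold_node n (k+1) hn i).2]

lemma tail_term (n : ℕ) (hn : 1 ≤ n) (r : ℝ) (hr : 2 ≤ r / n) (i : ℕ) :
    (n:ℝ)^r * ((i + n + 1 : ℕ):ℝ)^(-r) ≤ 2 ^ (2 - r/n) * ((i+1:ℕ):ℝ)^(-2:ℝ) := by
  have hn0 : (0:ℝ) < n := by exact_mod_cast hn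
  set s := r / n with hs
  have hrs : r = n * s := by rw [hs]; field_simp
  have hb : (1 + ((i:ℝ)+1)) ≤ (1 + ((i:ℝ)+1)/n)^n := by
    have h0 : 0 ≤ ((i:ℝ)+1)/n := by positivity
    have := one_add_mul_le_pow (a := ((i:ℝ)+1)/n) (by linarith) n
    rwa [mul_div_cancel₀ _ hn0.ne'] at this
  have e1 : (n:ℝ)^r * ((i + n + 1 : ℕ):ℝ)^(-r) = ((1 + ((i:ℝ)+1)/n)^n)^(-s) := by
    have : ((i + n + 1 : ℕ):ℝ) = n * (1 + ((i:ℝ)+1)/n) := by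
      push_cast; field_simp; ring
    rw [this, Real.mul_rpow hn0.le (by positivity), ← mul_assoc, ← Real.rpow_add hn0]
    rw [← Real.rpow_natCast, ← Real.rpow_mul (by positivity), hrs]
    simp
  rw [e1]
  have hi0 : (0:ℝ) ≤ i := by positivity
  calc ((1 + ((i:ℝ)+1)/n)^n)^(-s) ≤ (1 + ((i:ℝ)+1))^(-s) :=
        Real.rpow_le_rpow_of_nonpos (by positivity) hb (by linarith)
    _ = (1 + ((i:ℝ)+1))^(2-s) * (1 + ((i:ℝ)+1))^(-2:ℝ) := by
        rw [← Real.rpow_add (by positivity)]; ring_nf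
    _ ≤ 2 ^ (2 - s) * ((i+1:ℕ):ℝ)^(-2:ℝ) := by
        apply mul_le_mul
        · exact Real.rpow_le_rpow_of_nonpos (by norm_num) (by linarith) (by linarith)
        · exact Real.rpow_le_rpow_of_nonpos (by positivity) (by push_cast; linarith) (by norm_num)
        · positivity
        · positivity

noncomputable def tailC : ℝ := ∑' i : ℕ, ((i+1:ℕ):ℝ)^(-2:ℝ)

lemma tser_sub_tint (n : ℕ) (hn : 2 ≤ n) (a₀ r : ℝ) (hr : 1 < r) (hr2 : 2 ≤ r / n) (u v : ℕ → ℝ)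
    (hu : ∀ k, |u k| ≤ 1) (hv : ∀ k, |v k| ≤ 1) (x : ℝ) :
    |(n:ℝ)^r * (tser a₀ r u v x - tint n a₀ r u v x) -
      2 * (Real.sin ((2*n-1)*x/2) * (v (n-1) * Real.cos (x/2) - u (n-1) * Real.sin (x/2)))| ≤
      4 * (2 ^ (2 - r/n) * tailC) := by
  have hn0 : (0:ℝ) < n := by exact_mod_cast (by omega : 0 < n)
  have s1 := Summable.of_norm_bounded ((summ_psi r hr).mul_right 2) (ser_bound1 r u v hu hv x)
  have s2 := Summable.of_norm_bounded ((summ_psi r hr).mul_right 2) (ser_bound2 n r u v hu hv x)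
  set f1 : ℕ → ℝ := fun k => ((k+1 : ℕ):ℝ) ^ (-r) *
    (u k * Real.cos (((k+1 : ℕ):ℝ) * x) + v k * Real.sin (((k+1 : ℕ):ℝ) * x)) with hf1
  set f2 : ℕ → ℝ := fun k => ((k+1 : ℕ):ℝ) ^ (-r) *
    (u k * Real.cos (foldJ n (k+1) * x) + v k * (foldS n (k+1) * Real.sin (foldJ n (k+1) * x))) with hf2
  have e : tser a₀ r u v x - tint n a₀ r u v x = ∑' k, (f1 k - f2 k) := by
    unfold tser tint
    rw [Summable.tsum_sub s1 s2]
    ring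
  have s3 : Summable (fun k => f1 k - f2 k) := s1.sub s2
  have e2 := s3.sum_add_tsum_nat_add n
  obtain ⟨m, rfl⟩ : ∃ m, n = m + 1 := ⟨n-1, by omega⟩
  have e3 : ∑ k ∈ Finset.range (m+1), (f1 k - f2 k) = f1 m - f2 m := by
    rw [Finset.sum_range_succ, Finset.sum_eq_zero, zero_add]
    intro k hk
    have hk' : k + 1 < m + 1 := by have := Finset.mem_range.mp hk; omega
    simp only [hf1, hf2, (foldJ_of_lt (m+1) (k+1) hk').1, (foldJ_of_lt (m+1) (k+1) hk').2]
    ring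
  have e4 : ((m+1:ℕ):ℝ)^r * (f1 m - f2 m) = 2 * (Real.sin ((2*(m+1:ℕ)-1)*x/2) *
      (v (m+1-1) * Real.cos (x/2) - u (m+1-1) * Real.sin (x/2))) := by
    simp only [hf1, hf2, (foldJ_self (m+1) hn).1, (foldJ_self (m+1) hn).2, Nat.add_sub_cancel]
    have h1 : ((m+1:ℕ):ℝ)^r * ((m+1:ℕ):ℝ)^(-r) = 1 := by
      rw [← Real.rpow_add hn0]; simp
    rw [← mul_sub, ← mul_assoc, h1, one_mul]
    have h2 : ((m+1:ℕ):ℝ) * x = (2*(m+1:ℕ)-1)*x/2 + x/2 := by ring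
    have h3 : (m:ℝ) * x = (2*(m+1:ℕ)-1)*x/2 - x/2 := by push_cast; ring
    rw [h2, h3, Real.cos_add, Real.cos_sub, Real.sin_add, Real.sin_sub]
    ring
  rw [e, ← e2, e3, mul_add, e4, add_sub_cancel_left, ← tsum_mul_left]
  have bd : ∀ i : ℕ, ‖((m+1:ℕ):ℝ)^r * (f1 (i + (m+1)) - f2 (i+(m+1)))‖ ≤
      4 * (2 ^ (2 - r/(m+1:ℕ)) * ((i+1:ℕ):ℝ)^(-2:ℝ)) := by
    intro i
    have t := tail_term (m+1) (by omega) r hr2 i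
    have b1 := ser_bound1 r u v hu hv x (i+(m+1))
    have b2 := ser_bound2 (m+1) r u v hu hv x (i+(m+1))
    have hp : (0:ℝ) ≤ ((m+1:ℕ):ℝ)^r := by positivity
    rw [norm_mul, Real.norm_of_nonneg hp]
    calc _ ≤ ((m+1:ℕ):ℝ)^r * (((i + (m+1) + 1 : ℕ):ℝ)^(-r) * 2 + ((i + (m+1) + 1 : ℕ):ℝ)^(-r) * 2) := by
          apply mul_le_mul_of_nonneg_left _ hp
          exact (norm_sub_le _ _).trans (add_le_add b1 b2)
      _ = 4 * (((m+1:ℕ):ℝ)^r * ((i + (m+1) + 1 : ℕ):ℝ)^(-r)) := by ring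
      _ ≤ _ := by gcongr
  have hs := summ_psi 2 (by norm_num)
  have := tsum_of_norm_bounded (((hs.hasSum).mul_left (2 ^ (2 - r/(m+1:ℕ)))).mul_left 4) bd
  exact this

/-- cosine coefficient -/
noncomputable def cA (βb : ℕ → ℝ) (φ : ℝ → ℝ) (k : ℕ) : ℝ :=
  ∫ t in (0:ℝ)..(2*π), Real.cos ((k:ℝ) * t + π * βb k / 2) * φ t

/-- sine coefficient -/
noncomputable def cB (βb : ℕ → ℝ) (φ : ℝ → ℝ) (k : ℕ) : ℝ :=
  ∫ t in (0:ℝ)..(2*π), Real.sin ((k:ℝ) * t + π * βb k / 2) * φ t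

lemma adm_ii (φ : ℝ → ℝ) (h : AdmPhi φ) : IntervalIntegrable φ volume 0 (2*π) := by
  rw [intervalIntegrable_iff_integrableOn_Ioc_of_le (by positivity)]
  exact h.2.1

lemma adm_ii_mul (φ g : ℝ → ℝ) (h : AdmPhi φ) (hg : Continuous g) :
    IntervalIntegrable (fun t => g t * φ t) volume 0 (2*π) :=
  (adm_ii φ h).continuousOn_mul hg.continuousOn

lemma adm_bound (φ g : ℝ → ℝ) (h : AdmPhi φ) (hg : ∀ t, |g t| ≤ 1) :
    |∫ t in (0:ℝ)..(2*π), g t * φ t| ≤ 1 := by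
  have hp : (0:ℝ) ≤ 2*π := by positivity
  calc |∫ t in (0:ℝ)..(2*π), g t * φ t| ≤ ∫ t in (0:ℝ)..(2*π), |φ t| := by
        rw [← Real.norm_eq_abs]
        apply intervalIntegral.norm_integral_le_of_norm_le hp
        · apply ae_of_all
          intro t _
          rw [norm_mul]
          exact mul_le_of_le_one_left (norm_nonneg _) (hg t)
        · exact (adm_ii φ h).abs
    _ ≤ 1 := h.2.2.2

lemma adm_polar (βb : ℕ → ℝ) (φ : ℝ → ℝ) (h : AdmPhi φ) (k : ℕ) :
    ∃ ρ α : ℝ, 0 ≤ ρ ∧ ρ ≤ 1 ∧ cA βb φ k = -(ρ * Real.cos α) ∧ cB βb φ k = ρ * Real.sin α := by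
  let z : ℂ := ⟨-cA βb φ k, cB βb φ k⟩
  have h1 : ‖z‖ * Real.cos z.arg = -cA βb φ k := Complex.norm_mul_cos_arg z
  have h2 : ‖z‖ * Real.sin z.arg = cB βb φ k := Complex.norm_mul_sin_arg z
  refine ⟨‖z‖, z.arg, norm_nonneg _, ?_, by rw [h1]; ring, h2.symm⟩
  have h3 : ‖z‖ = ∫ t in (0:ℝ)..(2*π), (-Real.cos ((k:ℝ) * t + π * βb k / 2 + z.arg)) * φ t := by
    have : ∀ t, (-Real.cos ((k:ℝ) * t + π * βb k / 2 + z.arg)) * φ t =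
      (-Real.cos z.arg) * (Real.cos ((k:ℝ) * t + π * βb k / 2) * φ t) +
       Real.sin z.arg * (Real.sin ((k:ℝ) * t + π * βb k / 2) * φ t) := by
      intro t; rw [Real.cos_add]; ring
    simp_rw [this]
    rw [intervalIntegral.integral_add, intervalIntegral.integral_const_mul,
      intervalIntegral.integral_const_mul]
    · change _ = -Real.cos z.arg * cA βb φ k + Real.sin z.arg * cB βb φ k
      rw [← h2, show cA βb φ k = -(‖z‖ * Real.cos z.arg) by rw [h1]; ring]
      linear_combination (-‖z‖) * Real.sin_sq_add_cos_sq z.arg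
    · exact (adm_ii_mul φ _ h (by fun_prop)).const_mul _
    · exact (adm_ii_mul φ _ h (by fun_prop)).const_mul _
  rw [h3]
  refine (le_abs_self _).trans (adm_bound φ _ h ?_)
  intro t
  rw [abs_neg]; exact abs_cos_le_one _

lemma class_ser (r : ℝ) (hr : 1 < r) (βb : ℕ → ℝ) (φ : ℝ → ℝ) (h : AdmPhi φ) (a₀ x : ℝ) :
    a₀ / 2 + (1/π) * ∫ t in (0:ℝ)..(2*π), ker1 (fun k : ℕ => (k:ℝ) ^ (-r)) βb (x - t) * φ t =
    tser a₀ r (fun k => (1/π) * cA βb φ (k+1)) (fun k => (1/π) * cB βb φ (k+1)) x := by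
  have hp : (0:ℝ) ≤ 2*π := by positivity
  unfold tser
  congr 1
  let F : ℕ → ℝ → ℝ := fun k t => ((k+1 : ℕ):ℝ) ^ (-r) *
    (Real.cos (((k+1 : ℕ):ℝ) * x - (((k+1 : ℕ):ℝ) * t + π * βb (k+1) / 2)) * φ t)
  have hI : ∀ k, IntervalIntegrable (F k) volume 0 (2*π) := fun k =>
    (adm_ii_mul φ _ h (by fun_prop)).const_mul _
  have hI' : ∀ k, Integrable (F k) (volume.restrict (Ioc 0 (2*π))) := fun k =>
    (intervalIntegrable_iff_integrableOn_Ioc_of_le hp).mp (hI k)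
  have hS := hasSum_integral_of_summable_integral_norm hI' (by
    apply Summable.of_nonneg_of_le (fun k => integral_nonneg (fun _ => norm_nonneg _)) _ (summ_psi r hr)
    intro k
    rw [← intervalIntegral.integral_of_le hp]
    calc ∫ t in (0:ℝ)..(2*π), ‖F k t‖ ≤ ∫ t in (0:ℝ)..(2*π), ((k+1 : ℕ):ℝ) ^ (-r) * |φ t| := by
          apply intervalIntegral.integral_mono_on hp (hI k).norm ((adm_ii φ h).abs.const_mul _)
          intro t _
          simp only [F]
          rw [norm_mul, norm_mul, Real.norm_of_nonneg (psi_nonneg r k)]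
          gcongr
          exact mul_le_of_le_one_left (norm_nonneg _) (abs_cos_le_one _)
      _ = ((k+1 : ℕ):ℝ) ^ (-r) * ∫ t in (0:ℝ)..(2*π), |φ t| := by
          rw [intervalIntegral.integral_const_mul]
      _ ≤ ((k+1 : ℕ):ℝ) ^ (-r) := mul_le_of_le_one_right (psi_nonneg r k) h.2.2.2)
  have e1 : ∀ t, ker1 (fun k : ℕ => (k:ℝ) ^ (-r)) βb (x - t) * φ t = ∑' k, F k t := by
    intro t
    unfold ker1
    rw [← tsum_mul_right]
    apply tsum_congr
    intro k
    simp only [F]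
    push_cast
    rw [mul_assoc]
    congr 3
    ring
  rw [intervalIntegral.integral_of_le hp]
  simp_rw [e1]
  rw [← hS.tsum_eq, ← tsum_mul_left]
  apply tsum_congr
  intro k
  rw [← intervalIntegral.integral_of_le hp]
  simp only [F]
  have e2 : ∀ t, Real.cos (((k+1 : ℕ):ℝ) * x - (((k+1 : ℕ):ℝ) * t + π * βb (k+1) / 2)) * φ t =
    Real.cos (((k+1 : ℕ):ℝ) * x) * (Real.cos (((k+1 : ℕ):ℝ) * t + π * βb (k+1) / 2) * φ t) +
    Real.sin (((k+1 : ℕ):ℝ) * x) * (Real.sin (((k+1 : ℕ):ℝ) * t + π * βb (k+1) / 2) * φ t) := by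
    intro t; rw [Real.cos_sub]; ring
  rw [intervalIntegral.integral_const_mul]
  simp_rw [e2]
  rw [intervalIntegral.integral_add, intervalIntegral.integral_const_mul,
      intervalIntegral.integral_const_mul]
  · unfold cA cB; ring
  · exact (adm_ii_mul φ _ h (by fun_prop)).const_mul _
  · exact (adm_ii_mul φ _ h (by fun_prop)).const_mul _

lemma coef_bound (βb : ℕ → ℝ) (φ : ℝ → ℝ) (h : AdmPhi φ) (k : ℕ) :
    |(1/π) * cA βb φ k| ≤ 1 ∧ |(1/π) * cB βb φ k| ≤ 1 := by
  have hA : |cA βb φ k| ≤ 1 := adm_bound φ _ h (fun t => abs_cos_le_one _)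
  have hB : |cB βb φ k| ≤ 1 := adm_bound φ _ h (fun t => abs_sin_le_one _)
  have hpi : |1/π| ≤ 1 := by
    rw [abs_of_pos (by positivity), div_le_one (by positivity)]; linarith [Real.pi_gt_three]
  constructor
  · rw [abs_mul]; exact mul_le_one₀ hpi (abs_nonneg _) hA
  · rw [abs_mul]; exact mul_le_one₀ hpi (abs_nonneg _) hB

lemma per_int_comp (h : ℝ → ℝ) (hp : Function.Periodic h (2*π)) (hc : Continuous h) (n : ℕ)
    (hn : 1 ≤ n) (γ : ℝ) : ∫ t in (0:ℝ)..(2*π), h ((n:ℝ) * t + γ) = ∫ t in (0:ℝ)..(2*π), h t := by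
  have hn0 : (n:ℝ) ≠ 0 := by positivity
  rw [intervalIntegral.integral_comp_mul_add h hn0]
  have e : (n:ℝ) * (2*π) + γ = (n * 0 + γ) + (n:ℤ) • (2*π) := by simp; ring
  rw [e, hp.intervalIntegral_add_zsmul_eq _ _ (fun a b => hc.intervalIntegrable a b),
    hp.intervalIntegral_add_eq _ 0, zero_add]
  simp
  field_simp

lemma int_two_pi (g : ℝ → ℝ) (hc : Continuous g) : ∫ t in (0:ℝ)..(2*π), g t =
    (∫ t in (0:ℝ)..π, g t) + ∫ t in (0:ℝ)..π, g (t + π) := by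
  rw [intervalIntegral.integral_comp_add_right, zero_add,
    intervalIntegral.integral_add_adjacent_intervals (hc.intervalIntegrable _ _) (hc.intervalIntegrable _ _)]
  ring_nf

lemma exists_ext (βb : ℕ → ℝ) (n : ℕ) (hn : 1 ≤ n) (m : ℕ) :
    ∃ φ, AdmPhi φ ∧ cB βb φ n = 0 ∧ (2*m+2:ℝ)/(2*m+3) ≤ cA βb φ n := by
  let J : ℝ := 2 * ∫ t in (0:ℝ)..π, Real.sin t ^ (2*m+1)
  have hJpos : 0 < J := by
    have := integral_sin_pow_pos (n := 2*m+1)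
    simp only [J]; linarith
  let h : ℝ → ℝ := fun t => Real.sin t ^ (2*m+1) / J
  have hc : Continuous h := by fun_prop
  have hper : Function.Periodic h (2*π) := by intro t; simp [h]
  have i1 : ∫ t in (0:ℝ)..(2*π), h t = 0 := by
    rw [int_two_pi h hc]
    have : ∀ t, h (t+π) = - h t := by
      intro t; simp only [h, Real.sin_add_pi]; rw [Odd.neg_pow ⟨m, rfl⟩]; ring
    simp_rw [this]
    simp
  have i2 : ∫ t in (0:ℝ)..(2*π), |h t| = 1 := by
    rw [int_two_pi _ hc.abs]
    have : ∀ t, |h (t+π)| = |h t| := by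
      intro t; simp only [h, Real.sin_add_pi]; rw [Odd.neg_pow ⟨m, rfl⟩, neg_div, abs_neg]
    simp_rw [this]
    have e : ∫ t in (0:ℝ)..π, |h t| = ∫ t in (0:ℝ)..π, Real.sin t ^ (2*m+1) / J := by
      apply intervalIntegral.integral_congr
      intro t ht
      rw [uIcc_of_le Real.pi_pos.le] at ht
      have : 0 ≤ Real.sin t := Real.sin_nonneg_of_mem_Icc ht
      simp only [h]
      exact abs_of_nonneg (by positivity)
    rw [e, intervalIntegral.integral_div]
    rw [← add_div, ← two_mul]
    exact div_self hJpos.ne'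
  have i3 : ∫ t in (0:ℝ)..(2*π), Real.cos t * h t = 0 := by
    have : ∀ t, Real.cos t * h t = (Real.sin t ^ (2*m+1) * Real.cos t ^ (2*0+1)) / J := by
      intro t; simp only [h]; ring
    simp_rw [this]
    rw [intervalIntegral.integral_div, integral_sin_pow_mul_cos_pow_odd]
    simp
  have i4 : (2*m+2:ℝ)/(2*m+3) ≤ ∫ t in (0:ℝ)..(2*π), Real.sin t * h t := by
    have : ∀ t, Real.sin t * h t = Real.sin t ^ (2*m+2) / J := by
      intro t; simp only [h]; ring
    simp_rw [this]
    rw [int_two_pi _ (by fun_prop)]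
    have : ∀ t, Real.sin (t+π) ^ (2*m+2) = Real.sin t ^ (2*m+2) := by
      intro t; rw [Real.sin_add_pi, Even.neg_pow ⟨m+1, by ring⟩]
    simp_rw [this]
    rw [intervalIntegral.integral_div, ← add_div, ← two_mul, le_div_iff₀ hJpos]
    have a1 := integral_sin_pow_succ_le (2*m+2)
    have a2 := integral_sin_pow (a := 0) (b := π) (2*m+1)
    simp only [Real.sin_zero, Real.sin_pi] at a2
    rw [show 2*m+2+1 = 2*m+1+2 by ring, a2] at a1
    simp only [J]
    have : ((2*m+1:ℕ):ℝ) + 1 = 2*m+2 := by push_cast; ring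
    have h3 : ((2*m+1:ℕ):ℝ) + 2 = 2*m+3 := by push_cast; ring
    rw [this, h3] at a1
    simp at a1
    linarith
  let γ := π * βb n / 2
  refine ⟨fun t => h ((n:ℝ) * t + (γ + π/2)), ⟨?_, ?_, ?_, ?_⟩, ?_, ?_⟩
  · intro t
    have := hper.nat_mul n ((n:ℝ) * t + (γ + π/2))
    simp only
    rw [← this]
    congr 1; ring
  · exact (by fun_prop : Continuous (fun t => h ((n:ℝ) * t + (γ + π/2)))).continuousOn.integrableOn_Icc.mono_set Ioc_subset_Icc_self
  · rw [per_int_comp h hper hc n hn]; exact i1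
  · rw [per_int_comp (fun t => |h t|) (fun t => by simp only [hper t]) hc.abs n hn]; exact i2.le
  · unfold cB
    have : ∀ t, Real.sin ((n:ℝ) * t + π * βb n / 2) * h ((n:ℝ) * t + (γ + π/2)) =
       (fun s => -(Real.cos s * h s)) ((n:ℝ) * t + (γ + π/2)) := by
      intro t
      simp only [γ]
      rw [← add_assoc, Real.cos_add_pi_div_two]; ring
    simp_rw [this]
    rw [per_int_comp (fun s => -(Real.cos s * h s)) (fun t => by simp only [hper t, Real.cos_add_two_pi])
      (by fun_prop) n hn, intervalIntegral.integral_neg, i3, neg_zero]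
  · unfold cA
    have : ∀ t, Real.cos ((n:ℝ) * t + π * βb n / 2) * h ((n:ℝ) * t + (γ + π/2)) =
       (fun s => (Real.sin s * h s)) ((n:ℝ) * t + (γ + π/2)) := by
      intro t
      simp only [γ]
      rw [← add_assoc, Real.sin_add_pi_div_two]
    simp_rw [this]
    rw [per_int_comp (fun s => (Real.sin s * h s)) (fun t => by simp only [hper t, Real.sin_add_two_pi])
      (by fun_prop) n hn]
    exact i4

lemma per_memLp (p : ℝ≥0∞) (g : ℝ → ℝ) (hg : Continuous g) :
    MemLp g p (volume.restrict (Ioc (0:ℝ) (2*π))) := by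
  obtain ⟨C, hC⟩ := isCompact_Icc.exists_bound_of_continuousOn (s := Icc (0:ℝ) (2*π)) hg.continuousOn
  apply MemLp.of_bound hg.aestronglyMeasurable C
  rw [ae_restrict_iff' measurableSet_Ioc]
  exact ae_of_all _ (fun x hx => hC x (Ioc_subset_Icc_self hx))

lemma LpNormPer_nonneg (p : ℝ≥0∞) (g : ℝ → ℝ) : 0 ≤ LpNormPer p g := ENNReal.toReal_nonneg

lemma LpNormPer_add (p : ℝ≥0∞) (hp : 1 ≤ p) (f g : ℝ → ℝ) (hf : Continuous f) (hg : Continuous g) :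
    LpNormPer p (fun x => f x + g x) ≤ LpNormPer p f + LpNormPer p g := by
  unfold LpNormPer
  have h1 := (per_memLp p f hf).eLpNorm_lt_top.ne
  have h2 := (per_memLp p g hg).eLpNorm_lt_top.ne
  rw [← ENNReal.toReal_add h1 h2]
  apply ENNReal.toReal_mono (ENNReal.add_ne_top.mpr ⟨h1, h2⟩)
  exact eLpNorm_add_le hf.aestronglyMeasurable hg.aestronglyMeasurable hp

lemma LpNormPer_smul (p : ℝ≥0∞) (c : ℝ) (f : ℝ → ℝ) :
    LpNormPer p (fun x => c * f x) = |c| * LpNormPer p f := by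
  unfold LpNormPer
  have := eLpNorm_const_smul (μ := volume.restrict (Ioc (0:ℝ) (2*π))) c f p
  have e : (c • f) = fun x => c * f x := by ext; simp
  rw [e] at this
  rw [this, ENNReal.toReal_mul]
  simp

/-- total mass factor -/
noncomputable def massM (p : ℝ≥0∞) : ℝ :=
  ((volume.restrict (Ioc (0:ℝ) (2*π))) Set.univ ^ p.toReal⁻¹).toReal

lemma LpNormPer_bound (p : ℝ≥0∞) (f : ℝ → ℝ) (C : ℝ) (hC : 0 ≤ C) (h : ∀ x, |f x| ≤ C) :
    LpNormPer p f ≤ massM p * C := by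
  unfold LpNormPer massM
  have := eLpNorm_le_of_ae_bound (μ := volume.restrict (Ioc (0:ℝ) (2*π))) (p := p) (f := f) (C := C)
    (ae_of_all _ h)
  have h2 := ENNReal.toReal_mono (ENNReal.mul_ne_top (ENNReal.rpow_ne_top_of_nonneg
    (by positivity) (measure_ne_top _ _)) ENNReal.ofReal_ne_top) this
  rwa [ENNReal.toReal_mul, ENNReal.toReal_ofReal hC] at h2

lemma massM_nonneg (p : ℝ≥0∞) : 0 ≤ massM p := ENNReal.toReal_nonneg

lemma LpNormPer_top_eq_one (g : ℝ → ℝ) (hg : Continuous g) (h1 : ∀ x, |g x| ≤ 1) (x₀ : ℝ)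
    (hx : x₀ ∈ Ioc (0:ℝ) (2*π)) (h2 : |g x₀| = 1) : LpNormPer ⊤ g = 1 := by
  apply le_antisymm
  · have := LpNormPer_bound ⊤ g 1 zero_le_one h1
    simpa [massM] using this
  · have hfin := (per_memLp ⊤ g hg).eLpNorm_lt_top.ne
    set c := LpNormPer ⊤ g with hc
    have hae : ∀ᵐ x ∂(volume.restrict (Ioc (0:ℝ) (2*π))), |g x| ≤ c := by
      have := ae_le_eLpNormEssSup (f := g) (μ := volume.restrict (Ioc (0:ℝ) (2*π)))
      filter_upwards [this] with x hx
      rw [hc, LpNormPer, ← Real.norm_eq_abs, ← toReal_enorm]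
      exact ENNReal.toReal_mono hfin (by rwa [eLpNorm_exponent_top])
    have heq : (fun x => max |g x| c) =ᵐ[volume.restrict (Ioc (0:ℝ) (2*π))] (fun _ => c) := by
      filter_upwards [hae] with x hx
      exact max_eq_right hx
    have := Measure.eqOn_of_ae_eq heq (by fun_prop) (by fun_prop) (by
      rw [interior_Ioc, closure_Ioo (by positivity)]
      exact Ioc_subset_Icc_self) hx
    simp only at this
    rw [← h2, ← this]
    exact le_max_left _ _

lemma LpNormPer_eq (p : ℝ≥0∞) (hp : 1 ≤ p) (hp' : p ≠ ⊤) (g : ℝ → ℝ) (hg : Continuous g) :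
    LpNormPer p g = (∫ x in (0:ℝ)..(2*π), |g x| ^ p.toReal) ^ (p.toReal⁻¹) := by
  unfold LpNormPer
  rw [(per_memLp p g hg).eLpNorm_eq_integral_rpow_norm (by positivity) hp',
    intervalIntegral.integral_of_le (by positivity)]
  rw [ENNReal.toReal_ofReal]
  · rfl
  · apply Real.rpow_nonneg
    apply integral_nonneg
    intro x; positivity

lemma riemann_avg (H : ℝ → ℝ) (hc : Continuous H) (hper : Function.Periodic H (2*π)) (N : ℕ)
    (hN : 1 ≤ N) (ε : ℝ) (hω : ∀ x y, |x - y| ≤ 2*π/N → |H x - H y| ≤ ε) (y : ℝ) :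
    |(2*π/N) * ∑ j ∈ Finset.range N, H (y + j * (2*π/N)) - ∫ x in (0:ℝ)..(2*π), H x| ≤ 2*π*ε := by
  have hN0 : (0:ℝ) < N := by exact_mod_cast hN
  set d := 2*π/N with hd
  have hdpos : 0 < d := by positivity
  have hNd : N * d = 2*π := by rw [hd]; field_simp
  have e1 : ∫ x in (0:ℝ)..(2*π), H x =
      ∑ j ∈ Finset.range N, ∫ x in (y + j * d)..(y + (j+1:ℕ) * d), H x := by
    rw [intervalIntegral.sum_integral_adjacent_intervals (a := fun j : ℕ => y + j * d)
      (fun k _ => hc.intervalIntegrable _ _), hNd]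
    have := hper.intervalIntegral_add_eq 0 y
    simpa using this
  rw [e1, Finset.mul_sum, ← Finset.sum_sub_distrib]
  calc _ ≤ ∑ j ∈ Finset.range N, |d * H (y + j*d) - ∫ x in (y + j * d)..(y + (j+1:ℕ) * d), H x| :=
        Finset.abs_sum_le_sum_abs _ _
    _ ≤ ∑ j ∈ Finset.range N, ε * d := by
        apply Finset.sum_le_sum
        intro j _
        have e2 : d * H (y + j*d) = ∫ x in (y + j * d)..(y + (j+1:ℕ) * d), H (y + j*d) := by
          rw [intervalIntegral.integral_const]; push_cast; simp; left; ring
        rw [e2, ← intervalIntegral.integral_sub (by simp) (hc.intervalIntegrable _ _)]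
        have := intervalIntegral.norm_integral_le_of_norm_le_const (a := y + j*d) (b := y + (j+1:ℕ)*d)
          (f := fun x => H (y + j*d) - H x) (C := ε) (by
            intro x hx
            rw [uIoc_of_le (by push_cast; linarith)] at hx
            apply hω
            have h1 := hx.1
            have h2 := hx.2
            push_cast at h2
            rw [abs_le]; constructor <;> linarith)
        rw [Real.norm_eq_abs] at this
        have e3 : |y + (j+1:ℕ)*d - (y + j*d)| = d := by
          rw [← abs_of_pos hdpos]; congr 1; push_cast; rw [abs_of_pos hdpos]; ring
        rwa [e3] at this
    _ = 2*π*ε := by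
        rw [Finset.sum_const, Finset.card_range, nsmul_eq_mul, ← hNd]; ring

lemma fejer (H : ℝ → ℝ) (hc : Continuous H) (hper : Function.Periodic H (2*π))
    (hb : ∀ x, |H x| ≤ 1) (N : ℕ)
    (hN : 1 ≤ N) (ε : ℝ) (hω : ∀ x y, |x - y| ≤ 2*π/N → |H x - H y| ≤ ε) (c : ℝ) :
    |(∫ x in (0:ℝ)..(2*π), H (N * x) * H (x + c)) - (∫ x in (0:ℝ)..(2*π), H x)^2 / (2*π)| ≤ 2*π*ε := by
  have hN0 : (0:ℝ) < N := by exact_mod_cast hN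
  have hε : 0 ≤ ε := by
    have := hω 0 0 (by simp; positivity)
    simpa using this
  set d := 2*π/N with hd
  have hNd : N * d = 2*π := by rw [hd]; field_simp
  set K := ∫ x in (0:ℝ)..(2*π), H x with hK
  set I := ∫ x in (0:ℝ)..(2*π), H (N * x) * H (x + c) with hI
  have eF : ∫ x in (0:ℝ)..(2*π), H (N * x) = K := by
    have := per_int_comp H hper hc N hN 0
    simpa using this
  have s : ∀ j : ℕ, ∫ x in (0:ℝ)..(2*π), H (N * x) * H ((x + c) + j * d) = I := by
    intro j
    have e : ∀ x, H (N * x) * H ((x + c) + j * d) = (fun z => H (N * z) * H (z + c)) (x + j*d) := by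
      intro x
      have h1 : H (N * (x + j * d)) = H (N * x) := by
        have := hper.nat_mul j (N * x)
        rw [← this]; congr 1; rw [← hNd]; ring
      simp only [h1]
      congr 2; ring
    simp_rw [e]
    have hpp : Function.Periodic (fun z => H (N * z) * H (z + c)) (2*π) := by
      intro z
      have h1 : H (N * (z + 2*π)) = H (N * z) := by
        have := hper.nat_mul N (N * z)
        rw [← this]; congr 1; ring
      have h2 : H (z + 2*π + c) = H (z + c) := by
        rw [← hper (z + c)]; congr 1; ring
      simp only [h1, h2]
    have h3 := per_int_comp _ hpp (by fun_prop) 1 le_rfl (j * d)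
    simpa using h3
  have e2 : 2*π * I - K^2 = ∫ x in (0:ℝ)..(2*π), H (N * x) *
      (d * ∑ j ∈ Finset.range N, H ((x + c) + j * d) - K) := by
    have : ∀ x, H (N * x) * (d * ∑ j ∈ Finset.range N, H ((x + c) + j * d) - K) =
      d * (∑ j ∈ Finset.range N, H (N * x) * H ((x + c) + j * d)) - K * H (N * x) := by
      intro x; rw [← Finset.mul_sum]; ring
    simp_rw [this]
    rw [intervalIntegral.integral_sub ((by fun_prop : Continuous _).intervalIntegrable _ _)
      ((by fun_prop : Continuous _).intervalIntegrable _ _), intervalIntegral.integral_const_mul,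
      intervalIntegral.integral_const_mul, eF, intervalIntegral.integral_finsetSum
      (fun j _ => (by fun_prop : Continuous _).intervalIntegrable _ _),
      Finset.sum_congr rfl (fun j _ => s j), Finset.sum_const, Finset.card_range, nsmul_eq_mul, ← hNd]
    ring
  have e3 : |2*π * I - K^2| ≤ (2*π*ε) * (2*π) := by
    rw [e2]
    have := intervalIntegral.norm_integral_le_of_norm_le_const (a := 0) (b := 2*π)
      (f := fun x => H (N * x) * (d * ∑ j ∈ Finset.range N, H ((x + c) + j * d) - K)) (C := 2*π*ε) (by
        intro x _
        rw [norm_mul, ← one_mul (2*π*ε)]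
        exact mul_le_mul (hb _) (riemann_avg H hc hper N hN ε hω (x+c)) (norm_nonneg _) zero_le_one)
    rwa [sub_zero, abs_of_pos (by positivity)] at this
  have e4 : I - K^2/(2*π) = (2*π * I - K^2)/(2*π) := by field_simp
  rw [e4, abs_div, abs_of_pos (show (0:ℝ) < 2*π by positivity), div_le_iff₀ (by positivity)]
  exact e3

/-- `|sin(x/2)|^q` -/
noncomputable def hq (q x : ℝ) : ℝ := |Real.sin (x/2)| ^ q

lemma hq_cont (q : ℝ) (h : 1 ≤ q) : Continuous (hq q) := by
  unfold hq
  exact (by fun_prop : Continuous fun x : ℝ => |Real.sin (x/2)|).rpow_const (fun _ => Or.inr (by linarith))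

lemma hq_per (q : ℝ) : Function.Periodic (hq q) (2*π) := by
  intro x
  unfold hq
  rw [show (x + 2*π)/2 = x/2 + π by ring, Real.sin_add_pi, abs_neg]

lemma hq_bound (q : ℝ) (h : 1 ≤ q) (x : ℝ) : |hq q x| ≤ 1 := by
  unfold hq
  rw [abs_of_nonneg (by positivity)]
  exact Real.rpow_le_one (abs_nonneg _) (abs_sin_le_one _) (by linarith)

lemma hq_unif (q : ℝ) (h : 1 ≤ q) (ε : ℝ) (hε : 0 < ε) :
    ∃ δ > 0, ∀ x y, |x - y| ≤ δ → |hq q x - hq q y| ≤ ε := by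
  have h1 : UniformContinuousOn (fun x : ℝ => x ^ q) (Icc 0 1) :=
    isCompact_Icc.uniformContinuousOn_of_continuous
      (Real.continuous_rpow_const (by linarith)).continuousOn
  rw [Metric.uniformContinuousOn_iff_le] at h1
  obtain ⟨δ, hδ, H⟩ := h1 ε hε
  refine ⟨δ, hδ, fun x y hxy => ?_⟩
  have := H (|Real.sin (x/2)|) ⟨abs_nonneg _, abs_sin_le_one _⟩ (|Real.sin (y/2)|)
    ⟨abs_nonneg _, abs_sin_le_one _⟩ (by
      rw [Real.dist_eq]
      calc _ ≤ |Real.sin (x/2) - Real.sin (y/2)| := abs_abs_sub_abs_le _ _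
        _ ≤ |x/2 - y/2| := Real.abs_sin_sub_sin_le _ _
        _ = |x - y| / 2 := by rw [← sub_div, abs_div]; norm_num
        _ ≤ δ := by linarith [abs_nonneg (x-y)])
  rwa [Real.dist_eq] at this

lemma hq_int (q : ℝ) (h : 1 ≤ q) : ∫ x in (0:ℝ)..(2*π), hq q x = ∫ x in (0:ℝ)..(2*π), |Real.cos x| ^ q := by
  have hc : Continuous (fun x : ℝ => |Real.sin x| ^ q) :=
    (by fun_prop : Continuous fun x : ℝ => |Real.sin x|).rpow_const (fun _ => Or.inr (by linarith))
  have a1 := per_int_comp (fun x : ℝ => |Real.sin x| ^ q) (fun x => by simp) hc 1 le_rfl (π/2)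
  simp only [Nat.cast_one, one_mul, Real.sin_add_pi_div_two] at a1
  rw [a1, int_two_pi _ hc]
  simp only [Real.sin_add_pi, abs_neg]
  have := intervalIntegral.integral_comp_div (a := 0) (b := 2*π) (fun x : ℝ => |Real.sin x| ^ q) (two_ne_zero)
  unfold hq
  rw [this]
  simp
  ring

noncomputable def Lc (p : ℝ≥0∞) : ℝ := (2*π) ^ (-(1/p.toReal)) * (cosLp p)^2

lemma V_conv (p : ℝ≥0∞) (hp : 1 ≤ p) (ε : ℝ) (hε : 0 < ε) : ∀ᶠ n : ℕ in Filter.atTop,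
    (∀ α, LpNormPer p (fun x => Real.sin ((2*n-1)*x/2) * Real.sin (x/2+α)) ≤ Lc p + ε) ∧
    Lc p - ε ≤ LpNormPer p (fun x => Real.sin ((2*n-1)*x/2) * Real.sin (x/2)) := by
  have hsb : ∀ a b : ℝ, |Real.sin a * Real.sin b| ≤ 1 := by
    intro a b
    rw [abs_mul]; exact mul_le_one₀ (abs_sin_le_one _) (abs_nonneg _) (abs_sin_le_one _)
  by_cases htop : p = ⊤
  · subst htop
    have hcos : cosLp ⊤ = 1 := LpNormPer_top_eq_one _ Real.continuous_cos abs_cos_le_one π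
      ⟨Real.pi_pos, by linarith [Real.pi_pos]⟩ (by simp)
    have hL : Lc ⊤ = 1 := by simp [Lc, hcos]
    apply Filter.Eventually.of_forall
    intro n
    constructor
    · intro α
      have := LpNormPer_bound ⊤ (fun x => Real.sin ((2*n-1)*x/2) * Real.sin (x/2+α)) 1 zero_le_one
        (fun x => hsb _ _)
      have e : massM ⊤ = 1 := by simp [massM]
      rw [e] at this
      rw [hL]; linarith
    · rw [hL, LpNormPer_top_eq_one _ (by fun_prop) (fun x => hsb _ _) π
        ⟨Real.pi_pos, by linarith [Real.pi_pos]⟩]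
      · linarith
      · have : (2*(n:ℝ)-1)*π/2 = n * π - π/2 := by ring
        rw [this, Real.sin_sub_pi_div_two, Real.cos_nat_mul_pi]
        simp
  · set q := p.toReal with hq'
    have hq1 : 1 ≤ q := by
      have := ENNReal.toReal_mono htop hp
      simpa using this
    set K := ∫ x in (0:ℝ)..(2*π), |Real.cos x| ^ q with hK
    have hK0 : 0 ≤ K := by
      apply intervalIntegral.integral_nonneg (by positivity)
      intro x _; positivity
    have hL : Lc p = (K^2/(2*π))^(q⁻¹) := by
      unfold Lc cosLp
      rw [LpNormPer_eq p hp htop _ Real.continuous_cos, ← hq', ← hK,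
        Real.div_rpow (by positivity) (by positivity), ← Real.rpow_natCast, ← Real.rpow_natCast,
        ← Real.rpow_mul hK0, ← Real.rpow_mul hK0, one_div, Real.rpow_neg (by positivity), mul_comm q⁻¹]
      rw [mul_comm, div_eq_mul_inv]
    have hcont : ContinuousAt (fun x : ℝ => x ^ (q⁻¹)) (K^2/(2*π)) :=
      (Real.continuous_rpow_const (by positivity)).continuousAt
    rw [Metric.continuousAt_iff] at hcont
    obtain ⟨δ, hδ, hcl⟩ := hcont ε hε
    obtain ⟨η, hη, hun⟩ := hq_unif q hq1 (δ / (4*π)) (by positivity)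
    obtain ⟨n₀, hn₀⟩ := exists_nat_gt (2*π/η)
    have key : ∀ n : ℕ, max n₀ 1 ≤ n → ∀ α,
        |LpNormPer p (fun x => Real.sin ((2*n-1)*x/2) * Real.sin (x/2+α)) - Lc p| < ε := by
      intro n hn α
      have hn1 : 1 ≤ n := (le_max_right _ _).trans hn
      have hnn : n₀ ≤ n := (le_max_left _ _).trans hn
      have hNc : ((2*n-1 : ℕ) : ℝ) = 2 * (n:ℝ) - 1 := by
        rw [Nat.cast_sub (by omega)]; push_cast; ring
      have hlarge : 2*π/((2*n-1:ℕ):ℝ) ≤ η := by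
        have h1 : (n₀:ℝ) ≤ ((2*n-1:ℕ):ℝ) := by exact_mod_cast (by omega)
        have h2 : (0:ℝ) < ((2*n-1:ℕ):ℝ) := by exact_mod_cast (by omega)
        rw [div_le_iff₀ h2]
        rw [div_lt_iff₀ hη] at hn₀
        nlinarith
      have hf := fejer (hq q) (hq_cont q hq1) (hq_per q) (hq_bound q hq1) (2*n-1) (by omega)
        (δ/(4*π)) (fun x y hxy => hun x y (hxy.trans hlarge)) (2*α)
      rw [hq_int q hq1, ← hK] at hf
      rw [LpNormPer_eq p hp htop _ (by fun_prop), hL, ← Real.dist_eq]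
      apply hcl
      rw [Real.dist_eq]
      have e : ∀ x, |Real.sin ((2*n-1)*x/2) * Real.sin (x/2+α)| ^ q =
          hq q (((2*n-1:ℕ):ℝ) * x) * hq q (x + 2*α) := by
        intro x
        unfold hq
        rw [abs_mul, Real.mul_rpow (abs_nonneg _) (abs_nonneg _), hNc]
        congr 4
        ring
      simp_rw [← hq', e]
      refine hf.trans_lt ?_
      have : 2*π*(δ/(4*π)) = δ/2 := by field_simp; norm_num
      rw [this]; linarith
    filter_upwards [Filter.eventually_ge_atTop (max n₀ 1)] with n hn
    constructor
    · intro α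
      have := abs_lt.mp (key n hn α)
      linarith [this.2]
    · have := abs_lt.mp (key n hn 0)
      simp only [add_zero] at this
      linarith [this.1]

noncomputable def tauR (n : ℕ) (r : ℝ) : ℝ := 4 * (2 ^ (2 - r/n) * tailC)

lemma tailC_nonneg : 0 ≤ tailC := tsum_nonneg (fun _ => by positivity)

lemma tauR_nonneg (n : ℕ) (r : ℝ) : 0 ≤ tauR n r := by
  have := tailC_nonneg
  unfold tauR; positivity

lemma norm_close (p : ℝ≥0∞) (hp : 1 ≤ p) (n : ℕ) (hn : 2 ≤ n) (r : ℝ) (hr : 1 < r)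
    (hr2 : 2 ≤ r / n) (βb : ℕ → ℝ) (φ : ℝ → ℝ) (h : AdmPhi φ) (a₀ : ℝ) (f T : ℝ → ℝ)
    (hf : ∀ x : ℝ, f x = a₀ / 2 + (1/π) * ∫ t in (0:ℝ)..(2*π),
      ker1 (fun k : ℕ => (k:ℝ) ^ (-r)) βb (x - t) * φ t) (hT : InterpolatesAt n T f) :
    |(n:ℝ)^r * LpNormPer p (fun x => f x - T x) - (2/π) *
      LpNormPer p (fun x => Real.sin ((2*n-1)*x/2) *
        (cB βb φ n * Real.cos (x/2) - cA βb φ n * Real.sin (x/2)))| ≤ massM p * tauR n r := by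
  set u : ℕ → ℝ := fun k => (1/π) * cA βb φ (k+1) with hu
  set v : ℕ → ℝ := fun k => (1/π) * cB βb φ (k+1) with hv
  have hu1 : ∀ k, |u k| ≤ 1 := fun k => (coef_bound βb φ h (k+1)).1
  have hv1 : ∀ k, |v k| ≤ 1 := fun k => (coef_bound βb φ h (k+1)).2
  have hfe : f = tser a₀ r u v := by
    funext x; rw [hf x, class_ser r hr βb φ h a₀ x]
  have hTe : T = tint n a₀ r u v := by
    apply interp_unique n (by omega) T _ f hT
    rw [hfe]; exact tint_interp n (by omega) a₀ r hr u v hu1 hv1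
  have hfc : Continuous f := by rw [hfe]; exact tser_cont a₀ r hr u v hu1 hv1
  have hTc : Continuous T := by rw [hTe]; exact tint_cont n a₀ r hr u v hu1 hv1
  set G : ℝ → ℝ := fun x => Real.sin ((2*n-1)*x/2) *
        (cB βb φ n * Real.cos (x/2) - cA βb φ n * Real.sin (x/2)) with hG
  have hGc : Continuous G := by rw [hG]; fun_prop
  have hb : ∀ x, |(n:ℝ)^r * (f x - T x) - (2/π) * G x| ≤ tauR n r := by
    intro x
    have := tser_sub_tint n hn a₀ r hr hr2 u v hu1 hv1 x
    rw [← hfe, ← hTe] at this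
    change _ ≤ tauR n r at this
    convert this using 3
    simp only [hG, hu, hv, Nat.sub_add_cancel (show 1 ≤ n by omega)]
    ring
  have hb' : ∀ x, |(2/π) * G x - (n:ℝ)^r * (f x - T x)| ≤ tauR n r := by
    intro x; rw [abs_sub_comm]; exact hb x
  have n1 : LpNormPer p (fun x => (n:ℝ)^r * (f x - T x)) = (n:ℝ)^r * LpNormPer p (fun x => f x - T x) := by
    rw [LpNormPer_smul, abs_of_nonneg (by positivity)]
  have n2 : LpNormPer p (fun x => (2/π) * G x) = (2/π) * LpNormPer p G := by
    rw [LpNormPer_smul, abs_of_nonneg (by positivity)]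
  rw [← n1, ← n2]
  have c1 : Continuous (fun x => (n:ℝ)^r * (f x - T x)) := by fun_prop
  have c2 : Continuous (fun x => (2/π) * G x) := by fun_prop
  have t1 := LpNormPer_add p hp _ (fun x => (n:ℝ)^r * (f x - T x) - (2/π) * G x) c2 (by fun_prop)
  have t2 := LpNormPer_add p hp _ (fun x => (2/π) * G x - (n:ℝ)^r * (f x - T x)) c1 (by fun_prop)
  simp only [add_sub_cancel] at t1 t2
  have b1 := LpNormPer_bound p _ _ (tauR_nonneg n r) hb
  have b2 := LpNormPer_bound p _ _ (tauR_nonneg n r) hb'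
  rw [abs_le]
  constructor <;> linarith

lemma tauR_tendsto (r : ℕ → ℝ)
    (h : Filter.Tendsto (fun n : ℕ => r n / n) Filter.atTop Filter.atTop) :
    Filter.Tendsto (fun n => tauR n (r n)) Filter.atTop (nhds 0) := by
  have h1 : Filter.Tendsto (fun n : ℕ => (2:ℝ) ^ (2 - r n / n)) Filter.atTop (nhds 0) := by
    have : Filter.Tendsto (fun n : ℕ => 2 - r n / n) Filter.atTop Filter.atBot :=
      Filter.tendsto_atBot_add_const_left _ 2 (Filter.tendsto_neg_atTop_atBot.comp h)
    exact (tendsto_rpow_atBot_of_base_gt_one 2 (by norm_num)).comp this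
  have := (h1.mul_const tailC).const_mul 4
  simpa [tauR] using this

lemma target_eq (p : ℝ≥0∞) : 2 ^ ((1:ℝ) - 1/p.toReal) / π ^ ((1:ℝ) + 1/p.toReal) * (cosLp p) ^ 2 =
    (2/π) * Lc p := by
  unfold Lc
  rw [Real.rpow_sub (by norm_num), Real.rpow_add Real.pi_pos, Real.rpow_neg (by positivity),
    Real.mul_rpow (by norm_num) Real.pi_pos.le]
  simp only [Real.rpow_one]
  field_simp

/-- If `r_n > 1` and `r_n/n → ∞`, then
`n^{r_n} Ẽ_n(W^{r_n}_{β̄,1})_{L_p} → (2^{1−1/p}/π^{1+1/p})‖cos‖_p²`. -/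
theorem statement5 :
    ∀ (p : ℝ≥0∞), 1 ≤ p → ∀ (βb : ℕ → ℝ) (r : ℕ → ℝ),
      (∀ n : ℕ, 1 < r n) →
      Filter.Tendsto (fun n : ℕ => r n / n) Filter.atTop Filter.atTop →
      Filter.Tendsto
        (fun n : ℕ => (n:ℝ) ^ (r n) *
          interpErr p n (ClassC (fun k : ℕ => (k:ℝ) ^ (-(r n))) βb))
        Filter.atTop
        (nhds (2 ^ ((1:ℝ) - 1/p.toReal) / π ^ ((1:ℝ) + 1/p.toReal) * (cosLp p) ^ 2)) := by
  intro p hp βb r hr hlim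
  rw [target_eq, Metric.tendsto_nhds]
  intro ε hε
  have hM := massM_nonneg p
  have hτ := (tauR_tendsto r hlim).const_mul (massM p)
  rw [mul_zero] at hτ
  filter_upwards [V_conv p hp (ε/4) (by positivity), hτ.eventually (gt_mem_nhds (show 0 < ε/4 by positivity)),
    hlim.eventually_ge_atTop 2, Filter.eventually_ge_atTop 2] with n hV hτn hr2 hn
  have hpi2 : 2/π ≤ 1 := by
    rw [div_le_one Real.pi_pos]; linarith [Real.pi_gt_three]
  have hpi0 : 0 < 2/π := by positivity
  have hn0 : (0:ℝ) < n := by exact_mod_cast (by omega : 0 < n)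
  have hnr : (0:ℝ) < (n:ℝ)^(r n) := by positivity
  set S := { e : ℝ | ∃ f ∈ ClassC (fun k : ℕ => (k:ℝ) ^ (-(r n))) βb, ∃ T : ℝ → ℝ,
    InterpolatesAt n T f ∧ e = LpNormPer p (fun x => f x - T x) } with hS
  have hL0 : 0 ≤ Lc p := by unfold Lc; positivity
  have up : ∀ e ∈ S, (n:ℝ)^(r n) * e ≤ (2/π) * Lc p + ε/2 := by
    rintro e ⟨f, ⟨a₀, φ, hφ, hf⟩, T, hT, rfl⟩
    have hc := (abs_le.mp (norm_close p hp n hn (r n) (hr n) hr2 βb φ hφ a₀ f T hf hT)).2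
    obtain ⟨ρ, α, hρ0, hρ1, hA, hB⟩ := adm_polar βb φ hφ n
    have e1 : (fun x => Real.sin ((2*n-1)*x/2) *
        (cB βb φ n * Real.cos (x/2) - cA βb φ n * Real.sin (x/2))) =
        fun x => ρ * (Real.sin ((2*n-1)*x/2) * Real.sin (x/2+α)) := by
      funext x
      rw [hA, hB, Real.sin_add]; ring
    rw [e1, LpNormPer_smul, abs_of_nonneg hρ0] at hc
    have h1 := hV.1 α
    have h0 := LpNormPer_nonneg p (fun x => Real.sin ((2*n-1)*x/2) * Real.sin (x/2+α))
    have h2 := mul_le_of_le_one_left h0 hρ1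
    have h3 := mul_le_mul_of_nonneg_left (h2.trans h1) hpi0.le
    nlinarith
  have hbdd : BddAbove S := by
    refine ⟨((2/π) * Lc p + ε/2) / (n:ℝ)^(r n), fun e he => ?_⟩
    rw [le_div_iff₀ hnr, mul_comm]
    exact up e he
  have upper : (n:ℝ)^(r n) * sSup S ≤ (2/π) * Lc p + ε/2 := by
    rw [mul_comm, ← le_div_iff₀ hnr]
    apply Real.sSup_le
    · intro e he
      rw [le_div_iff₀ hnr, mul_comm]
      exact up e he
    · positivity
  have lower : (2/π) * Lc p - ε/2 ≤ (n:ℝ)^(r n) * sSup S := by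
    set V₀ := LpNormPer p (fun x => Real.sin ((2*n-1)*x/2) * Real.sin (x/2)) with hV0
    have hV00 : 0 ≤ V₀ := LpNormPer_nonneg _ _
    have hm : ∀ m : ℕ, (2/π) * ((2*m+2:ℝ)/(2*m+3) * V₀) - ε/4 ≤ (n:ℝ)^(r n) * sSup S := by
      intro m
      obtain ⟨φ, hφ, hB, hA⟩ := exists_ext βb n (by omega) m
      set f : ℝ → ℝ := fun x => (0:ℝ) / 2 + (1/π) * ∫ t in (0:ℝ)..(2*π),
        ker1 (fun k : ℕ => (k:ℝ) ^ (-(r n))) βb (x - t) * φ t with hf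
      have hfe : f = tser 0 (r n) (fun k => (1/π) * cA βb φ (k+1)) (fun k => (1/π) * cB βb φ (k+1)) := by
        funext x; exact class_ser (r n) (hr n) βb φ hφ 0 x
      have hT : InterpolatesAt n (tint n 0 (r n) (fun k => (1/π) * cA βb φ (k+1))
          (fun k => (1/π) * cB βb φ (k+1))) f := by
        rw [hfe]
        exact tint_interp n (by omega) 0 (r n) (hr n) _ _ (fun k => (coef_bound βb φ hφ (k+1)).1)
          (fun k => (coef_bound βb φ hφ (k+1)).2)
      have hc := (abs_le.mp (norm_close p hp n hn (r n) (hr n) hr2 βb φ hφ 0 f _ (fun x => rfl) hT)).1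
      have hmem := le_csSup hbdd (show _ ∈ S from ⟨f, ⟨0, φ, hφ, fun x => rfl⟩, _, hT, rfl⟩)
      have e1 : (fun x => Real.sin ((2*n-1)*x/2) *
        (cB βb φ n * Real.cos (x/2) - cA βb φ n * Real.sin (x/2))) =
        fun x => (-cA βb φ n) * (Real.sin ((2*n-1)*x/2) * Real.sin (x/2)) := by
        funext x
        rw [hB]; ring
      have hA0 : 0 ≤ cA βb φ n := le_trans (by positivity) hA
      rw [e1, LpNormPer_smul, abs_neg, abs_of_nonneg hA0, ← hV0] at hc
      have h1 := mul_le_mul_of_nonneg_left hmem hnr.le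
      have h2 := mul_le_mul_of_nonneg_left (mul_le_mul_of_nonneg_right hA hV00) hpi0.le
      linarith
    have hlimm : Filter.Tendsto (fun m : ℕ => (2/π) * ((2*m+2:ℝ)/(2*m+3) * V₀) - ε/4) Filter.atTop
        (nhds ((2/π) * (1 * V₀) - ε/4)) := by
      have : Filter.Tendsto (fun m : ℕ => (2*m+2:ℝ)/(2*m+3)) Filter.atTop (nhds 1) := by
        have h1 := (tendsto_one_div_add_atTop_nhds_zero_nat (𝕜 := ℝ))
        have h2 : Filter.Tendsto (fun m : ℕ => 1 - 1/((m:ℝ)+1)) Filter.atTop (nhds 1) := by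
          simpa using h1.const_sub 1
        refine tendsto_of_tendsto_of_tendsto_of_le_of_le h2 tendsto_const_nhds ?_ ?_
        · intro m
          have hm0 : (0:ℝ) ≤ m := by positivity
          change 1 - 1/((m:ℝ)+1) ≤ (2*m+2:ℝ)/(2*m+3)
          rw [le_div_iff₀ (by positivity)]
          have : (1 - 1/((m:ℝ)+1)) = m / (m+1) := by field_simp; ring
          rw [this, div_mul_eq_mul_div, div_le_iff₀ (by positivity)]
          nlinarith
        · intro m
          change (2*m+2:ℝ)/(2*m+3) ≤ 1
          rw [div_le_one (by positivity)]; linarith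
      exact ((this.mul_const V₀).const_mul (2/π)).sub_const (ε/4)
    have h1 := le_of_tendsto' hlimm hm
    have h2 := mul_le_mul_of_nonneg_left hV.2 hpi0.le
    nlinarith
  rw [Real.dist_eq, abs_lt]
  change -ε < (n:ℝ)^(r n) * sSup S - _ ∧ (n:ℝ)^(r n) * sSup S - _ < ε
  constructor <;> linarith
end

section
/- There exists an absolute constant C > 0 such that for every β ∈ ℝ, every n ∈ ℕ, and every real r with r ≥ n+1, one has | n^r Ẽ_n(W^r_{β,1})_{L_1} − 16/π² | ≤ C ( 1/n + e^{−r/(n+1)} ). -/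
open MeasureTheory Real Set
open scoped ENNReal

/-! ### Interpolation operator -/

noncomputable def nodeX (n : ℕ) (j : ℤ) : ℝ := 2 * (j:ℝ) * π / (2 * (n:ℝ) - 1)

noncomputable def DK (n : ℕ) (y : ℝ) : ℝ := 1 + 2 * ∑ k ∈ Finset.Icc 1 (n-1), Real.cos (k * y)

noncomputable def SI (n : ℕ) (f : ℝ → ℝ) (x : ℝ) : ℝ :=
  (1 / (2 * (n:ℝ) - 1)) * ∑ j ∈ Finset.range (2*n-1), f (nodeX n j) * DK n (x - nodeX n j)

lemma Npos {n : ℕ} (hn : 1 ≤ n) : (0:ℝ) < 2 * (n:ℝ) - 1 := by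
  have : (1:ℝ) ≤ n := by exact_mod_cast hn
  linarith

lemma Ncast {n : ℕ} (hn : 1 ≤ n) : ((2*n-1 : ℕ):ℝ) = 2 * (n:ℝ) - 1 := by
  rw [Nat.cast_sub (by omega)]; push_cast; ring

lemma tele_cos (a c : ℝ) (N : ℕ) :
    (∑ j ∈ Finset.range N, Real.cos (j * a - c)) * (2 * Real.sin (a/2)) =
      Real.sin (N * a - a/2 - c) - Real.sin (- a/2 - c) := by
  induction N with
  | zero => simp; ring_nf
  | succ N ih =>
    rw [Finset.sum_range_succ, add_mul, ih]
    have h1 : ((N+1:ℕ):ℝ) * a - a/2 - c = (N * a - c) + a/2 := by push_cast; ring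
    have h2 : (N:ℝ) * a - a/2 - c = (N * a - c) - a/2 := by ring
    rw [h1, h2, Real.sin_add, Real.sin_sub]; ring

lemma sin_node_ne {n : ℕ} (hn : 1 ≤ n) (p : ℤ) (hp : ¬ (2*(n:ℤ)-1) ∣ p) :
    Real.sin (nodeX n p / 2) ≠ 0 := by
  intro h
  rw [Real.sin_eq_zero_iff] at h
  obtain ⟨q, hq⟩ := h
  apply hp
  refine ⟨q, ?_⟩
  have hN := Npos hn
  unfold nodeX at hq
  have : (p:ℝ) = (2*n-1) * q := by
    field_simp at hq
    have := Real.pi_pos.ne'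
    linarith
  exact_mod_cast this

lemma sum_cos_node {n : ℕ} (hn : 1 ≤ n) (p : ℤ) (hp : ¬ (2*(n:ℤ)-1) ∣ p) (c : ℝ) :
    ∑ j ∈ Finset.range (2*n-1), Real.cos (p * nodeX n j - c) = 0 := by
  have hN := Npos hn
  have h := tele_cos (nodeX n p) c (2*n-1)
  have hs := sin_node_ne hn p hp
  have e : ((2*n-1:ℕ):ℝ) * nodeX n p - nodeX n p / 2 - c = (- nodeX n p / 2 - c) + p * (2*π) := by
    rw [Ncast hn]; unfold nodeX; field_simp; ring
  rw [e, Real.sin_add_int_mul_two_pi, sub_self] at h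
  have h2 : ∑ j ∈ Finset.range (2*n-1), Real.cos (p * nodeX n j - c) =
      ∑ j ∈ Finset.range (2*n-1), Real.cos (j * nodeX n p - c) := by
    apply Finset.sum_congr rfl; intro j _
    congr 2; unfold nodeX; push_cast; ring
  rw [h2]
  rcases mul_eq_zero.1 h with h | h
  · exact h
  · exact absurd (by linarith) hs

lemma tele_DK (y : ℝ) (m : ℕ) :
    (1 + 2 * ∑ k ∈ Finset.Icc 1 m, Real.cos (k * y)) * Real.sin (y/2) = Real.sin (m * y + y/2) := by
  induction m with
  | zero => simp
  | succ m ih =>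
    rw [Finset.sum_Icc_succ_top (by omega)]
    have : (1 + 2 * (∑ k ∈ Finset.Icc 1 m, Real.cos (k * y) + Real.cos ((m+1:ℕ) * y))) * Real.sin (y/2)
      = Real.sin (m * y + y/2) + 2 * Real.cos ((m+1:ℕ) * y) * Real.sin (y/2) := by rw [← ih]; ring
    rw [this]
    have h1 : (m:ℝ) * y + y/2 = ((m+1:ℕ):ℝ) * y - y/2 := by push_cast; ring
    rw [h1, Real.sin_add, Real.sin_sub]; ring

lemma DK_zero {n : ℕ} (hn : 1 ≤ n) (p : ℤ) (hp : ¬ (2*(n:ℤ)-1) ∣ p) : DK n (nodeX n p) = 0 := by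
  have hN := Npos hn
  have h := tele_DK (nodeX n p) (n-1)
  have e : ((n-1:ℕ):ℝ) * nodeX n p + nodeX n p / 2 = p * π := by
    have hX : nodeX n p * (2 * (n:ℝ) - 1) = 2 * p * π := by
      unfold nodeX; rw [div_mul_cancel₀ _ hN.ne']
    rw [Nat.cast_sub hn]; push_cast; linear_combination (1/2) * hX
  rw [e, Real.sin_int_mul_pi] at h
  exact (mul_eq_zero.1 h).resolve_right (sin_node_ne hn p hp)

lemma DK_node {n : ℕ} (hn : 1 ≤ n) (q : ℤ) : DK n (nodeX n ((2*(n:ℤ)-1)*q)) = 2 * (n:ℝ) - 1 := by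
  have hN := Npos hn
  unfold DK
  have : ∀ k ∈ Finset.Icc 1 (n-1), Real.cos (k * nodeX n ((2*(n:ℤ)-1)*q)) = 1 := by
    intro k _
    have : (k:ℝ) * nodeX n ((2*(n:ℤ)-1)*q) = ((k*q : ℤ):ℝ) * (2*π) := by
      unfold nodeX; push_cast; field_simp
    rw [this, Real.cos_int_mul_two_pi]
  rw [Finset.sum_congr rfl this]
  simp [Nat.cast_sub hn]; ring

lemma node_sub (n : ℕ) (l j : ℤ) : nodeX n l - nodeX n j = nodeX n (l - j) := by
  unfold nodeX; push_cast; ring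

lemma SI_interp {n : ℕ} (hn : 1 ≤ n) (f : ℝ → ℝ) (hf : ∀ x, f (x + 2*π) = f x) (l : ℤ) :
    SI n f (nodeX n l) = f (nodeX n l) := by
  have hN := Npos hn
  have hNz : (0:ℤ) < 2*(n:ℤ)-1 := by omega
  have hp : Function.Periodic f (2*π) := hf
  set j0 : ℕ := (l % (2*(n:ℤ)-1)).toNat with hj0
  have hj0c : (j0:ℤ) = l % (2*(n:ℤ)-1) := Int.toNat_of_nonneg (Int.emod_nonneg _ hNz.ne')
  have hj0lt : (j0:ℤ) < 2*(n:ℤ)-1 := by rw [hj0c]; exact Int.emod_lt_of_pos _ hNz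
  have hl : l - j0 = (2*(n:ℤ)-1) * (l / (2*(n:ℤ)-1)) := by
    rw [hj0c]; have := Int.emod_add_mul_ediv l (2*(n:ℤ)-1); linarith
  unfold SI
  rw [Finset.sum_eq_single j0]
  · rw [node_sub, hl, DK_node hn]
    have : f (nodeX n l) = f (nodeX n j0) := by
      have e : nodeX n l = nodeX n j0 + (l / (2*(n:ℤ)-1) : ℤ) * (2*π) := by
        have : nodeX n l = nodeX n j0 + nodeX n (l - j0) := by rw [← node_sub]; ring
        rw [this, hl]; congr 1; unfold nodeX
        generalize (l / (2*(n:ℤ)-1)) = q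
        push_cast; field_simp
      rw [e]; exact hp.int_mul _ _
    rw [this]; field_simp
  · intro j hj hne
    rw [node_sub, DK_zero hn, mul_zero]
    rintro ⟨q, hq⟩
    have hj' := Finset.mem_range.1 hj
    have : (j0:ℤ) - j = (2*(n:ℤ)-1) * (q - l / (2*(n:ℤ)-1)) := by
      rw [mul_sub, ← hq, ← hl]; ring
    have h0 : q - l / (2*(n:ℤ)-1) = 0 := by
      by_contra h
      rcases lt_or_gt_of_ne h with h | h <;> nlinarith [(by omega : (j:ℤ) < 2*(n:ℤ)-1)]
    rw [h0] at this
    omega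
  · intro h; exfalso; apply h; rw [Finset.mem_range]; omega

lemma SI_trig {n : ℕ} (f : ℝ → ℝ) : IsTrigPolyDeg (n-1) (SI n f) := by
  refine ⟨fun k => (2 / (2 * (n:ℝ) - 1)) * ∑ j ∈ Finset.range (2*n-1), f (nodeX n j) * Real.cos (k * nodeX n j),
    fun k => (2 / (2 * (n:ℝ) - 1)) * ∑ j ∈ Finset.range (2*n-1), f (nodeX n j) * Real.sin (k * nodeX n j), ?_⟩
  intro x
  unfold SI DK
  have : ∀ j : ℕ, f (nodeX n j) * (1 + 2 * ∑ k ∈ Finset.Icc 1 (n-1), Real.cos (k * (x - nodeX n j))) =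
     f (nodeX n j) + ∑ k ∈ Finset.Icc 1 (n-1), 2 * f (nodeX n j) * Real.cos (k * (x - nodeX n j)) := by
    intro j; rw [mul_add, mul_one, Finset.mul_sum, Finset.mul_sum]; congr 1
    apply Finset.sum_congr rfl; intros; ring
  simp only [this]
  rw [Finset.sum_add_distrib, Finset.sum_comm, mul_add]
  congr 1
  · simp; ring
  · rw [Finset.mul_sum]
    apply Finset.sum_congr rfl; intro k _
    simp only [Finset.mul_sum, Finset.sum_mul, ← Finset.sum_add_distrib]
    apply Finset.sum_congr rfl; intro j _
    rw [mul_sub, Real.cos_sub]; ring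

lemma SI_cos {n : ℕ} (hn : 1 ≤ n) (m : ℕ) (hm : m < n) (c x : ℝ) :
    SI n (fun y => Real.cos (m * y - c)) x = Real.cos (m * x - c) := by
  have hN := Npos hn
  have key : ∀ p : ℤ, p ≠ 0 → |p| < 2*(n:ℤ)-1 → ∀ c : ℝ,
      ∑ j ∈ Finset.range (2*n-1), Real.cos (p * nodeX n j - c) = 0 := by
    intro p hp hlt c
    apply sum_cos_node hn
    intro hd
    exact hp (Int.eq_zero_of_abs_lt_dvd hd hlt)
  unfold SI DK
  have : ∀ j : ℕ, Real.cos (m * nodeX n j - c) * (1 + 2 * ∑ k ∈ Finset.Icc 1 (n-1), Real.cos (k * (x - nodeX n j))) =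
     Real.cos (m * nodeX n j - c) + ∑ k ∈ Finset.Icc 1 (n-1),
       (Real.cos (((m:ℤ)-(k:ℤ) : ℤ) * nodeX n j - (c - k * x)) + Real.cos (((m:ℤ)+(k:ℤ) : ℤ) * nodeX n j - (c + k * x))) := by
    intro j; rw [mul_add, mul_one, Finset.mul_sum, Finset.mul_sum]; congr 1
    apply Finset.sum_congr rfl; intro k _
    have h1 : (((m:ℤ)-(k:ℤ) : ℤ):ℝ) * nodeX n j - (c - k * x) = (m * nodeX n j - c) + k * (x - nodeX n j) := by
      push_cast; ring
    have h2 : (((m:ℤ)+(k:ℤ) : ℤ):ℝ) * nodeX n j - (c + k * x) = (m * nodeX n j - c) - k * (x - nodeX n j) := by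
      push_cast; ring
    rw [h1, h2, Real.cos_add (m * nodeX n j - c), Real.cos_sub (m * nodeX n j - c)]; ring
  simp only [this]
  rw [Finset.sum_add_distrib, Finset.sum_comm]
  have hs : ∀ k ∈ Finset.Icc 1 (n-1), ∑ j ∈ Finset.range (2*n-1),
      (Real.cos (((m:ℤ)-(k:ℤ) : ℤ) * nodeX n j - (c - k * x)) + Real.cos (((m:ℤ)+(k:ℤ) : ℤ) * nodeX n j - (c + k * x)))
      = if k = m then (2 * (n:ℝ) - 1) * Real.cos (m * x - c) else 0 := by
    intro k hk
    have hk' := Finset.mem_Icc.1 hk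
    rw [Finset.sum_add_distrib, key ((m:ℤ)+(k:ℤ)) (by omega) (by rw [abs_lt]; omega), add_zero]
    split_ifs with h
    · subst h
      simp [Ncast hn]
    · exact key _ (by omega) (by rw [abs_lt]; omega) _
  rw [Finset.sum_congr rfl hs]
  rcases Nat.eq_zero_or_pos m with h0 | h0
  · subst h0
    rw [Finset.sum_eq_zero (s := Finset.Icc 1 (n-1))]
    · simp [Ncast hn]; field_simp
    · intro k hk; have hk' := Finset.mem_Icc.1 hk
      rw [if_neg (by omega)]
  · have := key (m:ℤ) (by omega) (by rw [abs_lt]; omega) c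
    push_cast at this
    rw [this, Finset.sum_ite_eq', if_pos (by rw [Finset.mem_Icc]; omega), zero_add]
    field_simp

lemma SI_cosZ {n : ℕ} (hn : 1 ≤ n) (m : ℤ) (hm : |m| < n) (c x : ℝ) :
    SI n (fun y => Real.cos (m * y - c)) x = Real.cos (m * x - c) := by
  obtain ⟨k, rfl | rfl⟩ := Int.eq_nat_or_neg m
  · exact_mod_cast SI_cos hn k (by simpa using hm) c x
  · have h := SI_cos hn k (by simpa using hm) (-c) x
    have e : ∀ y : ℝ, Real.cos (((-(k:ℤ):ℤ):ℝ) * y - c) = Real.cos (k * y - (-c)) := by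
      intro y; rw [← Real.cos_neg]; congr 1; push_cast; ring
    simp only [e]; exact h

lemma SI_congr {n : ℕ} (f g : ℝ → ℝ) (h : ∀ j : ℤ, f (nodeX n j) = g (nodeX n j)) (x : ℝ) :
    SI n f x = SI n g x := by
  unfold SI; simp only [h]

lemma SI_add {n : ℕ} (f g : ℝ → ℝ) (x : ℝ) :
    SI n (fun y => f y + g y) x = SI n f x + SI n g x := by
  unfold SI; simp only [add_mul, Finset.sum_add_distrib, mul_add]

lemma SI_smul {n : ℕ} (a : ℝ) (f : ℝ → ℝ) (x : ℝ) :
    SI n (fun y => a * f y) x = a * SI n f x := by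
  unfold SI; simp only [mul_assoc, ← Finset.mul_sum]; ring

lemma SI_sum {n : ℕ} (s : Finset ℕ) (f : ℕ → ℝ → ℝ) (x : ℝ) :
    SI n (fun y => ∑ k ∈ s, f k y) x = ∑ k ∈ s, SI n (f k) x := by
  unfold SI; rw [← Finset.mul_sum, Finset.sum_comm]; simp only [Finset.sum_mul]

lemma SI_const {n : ℕ} (hn : 1 ≤ n) (a x : ℝ) : SI n (fun _ => a) x = a := by
  have := SI_cos hn 0 (by omega) 0 x
  simp at this
  have h := SI_smul (n := n) a (fun _ => 1) x
  simpa [this] using h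

lemma SI_unique {n : ℕ} (hn : 1 ≤ n) (T f : ℝ → ℝ) (h : InterpolatesAt n T f) (x : ℝ) :
    T x = SI n f x := by
  obtain ⟨⟨a, b, hT⟩, hi⟩ := h
  rw [← SI_congr T f hi x]
  have hT' : T = fun x => a 0 / 2 +
    ∑ k ∈ Finset.Icc 1 (n-1), (a k * Real.cos (k * x) + b k * Real.sin (k * x)) := funext hT
  rw [hT x, hT', SI_add, SI_const hn, SI_sum]
  congr 1
  apply Finset.sum_congr rfl
  intro k hk
  have hk' := Finset.mem_Icc.1 hk
  rw [SI_add, SI_smul, SI_smul]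
  have h1 := SI_cos hn k (by omega) 0 x
  have h2 := SI_cos hn k (by omega) (π/2) x
  simp only [Real.cos_sub_pi_div_two, sub_zero] at h1 h2
  rw [h1, h2]

/-- aliasing -/
lemma SI_alias {n : ℕ} (hn : 1 ≤ n) (k : ℤ) (m q : ℤ) (hm : |m| < n)
    (hk : k = m + (2*(n:ℤ)-1) * q) (c x : ℝ) :
    SI n (fun y => Real.cos (k * y - c)) x = Real.cos (m * x - c) := by
  have hN := Npos hn
  rw [← SI_cosZ hn m hm c x]
  apply SI_congr
  intro j
  have : (k:ℝ) * nodeX n j - c = (m * nodeX n j - c) + ((q*j:ℤ):ℝ) * (2*π) := by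
    rw [hk]; unfold nodeX; push_cast; field_simp; ring
  simp only [this, Real.cos_add_int_mul_two_pi]

lemma SI_alias_ex {n : ℕ} (hn : 1 ≤ n) (k : ℤ) : ∃ m : ℤ, |m| < n ∧ ∃ q, k = m + (2*(n:ℤ)-1) * q := by
  have hNz : (0:ℤ) < 2*(n:ℤ)-1 := by omega
  refine ⟨(k + (n-1)) % (2*(n:ℤ)-1) - (n-1), ?_, (k + (n-1)) / (2*(n:ℤ)-1), ?_⟩
  · have h1 := Int.emod_nonneg (k + (n-1)) hNz.ne'
    have h2 := Int.emod_lt_of_pos (k + (n-1)) hNz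
    rw [abs_lt]; omega
  · have := Int.emod_add_mul_ediv (k + (n-1)) (2*(n:ℤ)-1); linarith

/-- error of a single harmonic -/
noncomputable def eH (n : ℕ) (k : ℕ) (c x : ℝ) : ℝ :=
  Real.cos (k * x - c) - SI n (fun y => Real.cos (k * y - c)) x

lemma eH_bound {n : ℕ} (hn : 1 ≤ n) (k : ℕ) (c x : ℝ) : |eH n k c x| ≤ 2 := by
  obtain ⟨m, hm, q, hq⟩ := SI_alias_ex hn (k:ℤ)
  have := SI_alias hn _ m q hm hq c x
  unfold eH
  push_cast at this
  rw [this]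
  have h1 := abs_cos_le_one (k * x - c)
  have h2 := abs_cos_le_one (m * x - c)
  rw [abs_le] at *
  constructor <;> linarith

lemma eH_small {n : ℕ} (hn : 1 ≤ n) (k : ℕ) (hk : k < n) (c x : ℝ) : eH n k c x = 0 := by
  unfold eH; rw [SI_cos hn k hk, sub_self]

lemma eH_n {n : ℕ} (hn : 1 ≤ n) (c x : ℝ) :
    eH n n c x = -2 * Real.sin ((2*(n:ℝ)-1) * x / 2) * Real.sin (x/2 - c) := by
  have := SI_alias hn (n:ℤ) (1 - n) 1 (by rw [abs_lt]; omega) (by ring) c x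
  unfold eH
  push_cast at this
  rw [this, Real.cos_sub_cos]
  have h1 : (n * x - c + ((1 - (n:ℝ)) * x - c)) / 2 = x/2 - c := by ring
  have h2 : (n * x - c - ((1 - (n:ℝ)) * x - c)) / 2 = (2*(n:ℝ)-1) * x / 2 := by ring
  rw [h1, h2]; ring

/-! ### Tail sums -/

lemma summable_psi (r : ℝ) (hr : 1 < r) : Summable (fun k : ℕ => (((k+1:ℕ):ℝ)) ^ (-r)) :=
  (summable_nat_add_iff 1).2 (Real.summable_nat_rpow.2 (by linarith))

lemma tail_bound {n : ℕ} (hn : 1 ≤ n) (r : ℝ) (hr : (n:ℝ) + 1 ≤ r) :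
    ∑' k : ℕ, (((k+n+1:ℕ):ℝ)) ^ (-r) ≤ 3 * ((n:ℝ) ^ (-r) * Real.exp (-r / ((n:ℝ)+1))) := by
  have hn' : (1:ℝ) ≤ n := by exact_mod_cast hn
  have hs : Summable (fun k : ℕ => (((k+n+1:ℕ):ℝ)) ^ (-r)) := by
    have := (summable_nat_add_iff (n+1)).2 (Real.summable_nat_rpow (p := -r).2 (by linarith))
    exact this
  have h1 : ((n:ℝ)+1) ^ (-r) ≤ (n:ℝ) ^ (-r) * Real.exp (-r / ((n:ℝ)+1)) := by
    have hlog := Real.one_sub_inv_le_log_of_pos (x := ((n:ℝ)+1)/n) (by positivity)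
    rw [Real.log_div (by positivity) (by positivity)] at hlog
    have e : 1 - (((n:ℝ)+1)/n)⁻¹ = 1 / (n+1) := by field_simp; ring
    rw [e] at hlog
    rw [Real.rpow_def_of_pos (by positivity), Real.rpow_def_of_pos (by positivity), ← Real.exp_add]
    apply Real.exp_le_exp.2
    have : r * (1 / ((n:ℝ)+1)) ≤ r * (Real.log (n+1) - Real.log n) :=
      mul_le_mul_of_nonneg_left hlog (by linarith)
    have e2 : -r / ((n:ℝ)+1) = - (r * (1 / ((n:ℝ)+1))) := by ring
    rw [e2]; linarith
  have h2 : ∑' k : ℕ, (((k+n+1:ℕ):ℝ)) ^ (-r) ≤ 3 * ((n:ℝ)+1) ^ (-r) := by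
    rw [hs.tsum_eq_zero_add]
    have h3 : ∑' k : ℕ, ((((k+1)+n+1:ℕ):ℝ)) ^ (-r) ≤ 2 * ((n:ℝ)+1) ^ (-r) := by
      apply Real.tsum_le_of_sum_range_le (fun k => by positivity)
      intro a
      have hanti : AntitoneOn (fun x : ℝ => x ^ (-r)) (Icc ((n:ℝ)+1) ((n:ℝ)+1 + a)) := by
        intro x hx y hy hxy
        exact Real.rpow_le_rpow_of_nonpos (by linarith [hx.1]) hxy (by linarith)
      have := hanti.sum_le_integral
      rw [integral_rpow (Or.inr ⟨by linarith, by
        rw [uIcc_of_le (by linarith [(Nat.cast_nonneg a : (0:ℝ) ≤ a)])]; intro h; linarith [h.1]⟩)] at this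
      have e : ∑ i ∈ Finset.range a, ((((i+1)+n+1:ℕ):ℝ)) ^ (-r) =
          ∑ i ∈ Finset.range a, ((n:ℝ)+1 + ((i+1:ℕ):ℝ)) ^ (-r) := by
        apply Finset.sum_congr rfl; intro i _; congr 1; push_cast; ring
      rw [e]
      refine this.trans ?_
      have hp : (0:ℝ) ≤ ((n:ℝ)+1+a) ^ (-r+1) := by positivity
      have e3 : ((n:ℝ)+1) ^ (-r+1) = ((n:ℝ)+1) ^ (-r) * (n+1) := by
        rw [Real.rpow_add (by positivity), Real.rpow_one]
      have hq : (0:ℝ) < ((n:ℝ)+1) ^ (-r) := by positivity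
      rw [← neg_div_neg_eq, div_le_iff₀ (by linarith), e3]
      nlinarith
    have : ((0+n+1:ℕ):ℝ) = n+1 := by push_cast; ring
    rw [this]; linarith
  linarith

/-! ### The main integral -/

noncomputable def JJ (n : ℕ) (γ : ℝ) : ℝ :=
  ∫ x in (0:ℝ)..(2*π), |Real.sin ((2*(n:ℝ)-1) * x / 2)| * |Real.sin (x/2 + γ)|

lemma JJ_lip (n : ℕ) (γ γ' : ℝ) : |JJ n γ - JJ n γ'| ≤ 2 * π * |γ - γ'| := by
  unfold JJ
  rw [← intervalIntegral.integral_sub (Continuous.intervalIntegrable (by fun_prop) _ _)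
    (Continuous.intervalIntegrable (by fun_prop) _ _)]
  have := intervalIntegral.norm_integral_le_of_norm_le_const (a := 0) (b := 2*π) (C := |γ - γ'|)
    (f := fun x => |Real.sin ((2*(n:ℝ)-1) * x / 2)| * |Real.sin (x/2 + γ)| -
      |Real.sin ((2*(n:ℝ)-1) * x / 2)| * |Real.sin (x/2 + γ')|) (by
      intro x _
      rw [← mul_sub, Real.norm_eq_abs, abs_mul, abs_abs]
      have h1 := Real.abs_sin_le_one ((2*(n:ℝ)-1) * x / 2)
      have h2 : |(|Real.sin (x/2 + γ)| - |Real.sin (x/2 + γ')|)| ≤ |γ - γ'| := by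
        refine (abs_abs_sub_abs_le_abs_sub _ _).trans ?_
        have hl := Real.lipschitzWith_sin.dist_le_mul (x/2+γ) (x/2+γ')
        simpa [Real.dist_eq] using hl
      calc _ ≤ 1 * |γ - γ'| := mul_le_mul h1 h2 (abs_nonneg _) zero_le_one
        _ = _ := one_mul _)
  rw [Real.norm_eq_abs, sub_zero, abs_of_pos (by positivity : (0:ℝ) < 2*π)] at this
  linarith

lemma abs_sin_add_nat_pi (x : ℝ) (k : ℤ) : |Real.sin (x + k * π)| = |Real.sin x| := by
  rw [Real.sin_add_int_mul_pi, abs_mul]; simp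

lemma JJ_per {n : ℕ} (hn : 1 ≤ n) : Function.Periodic (JJ n) (π / (2*(n:ℝ)-1)) := by
  intro γ
  have hN := Npos hn
  set h : ℝ → ℝ := fun x => |Real.sin ((2*(n:ℝ)-1) * x / 2)| * |Real.sin (x/2 + γ)| with hh
  have hper : Function.Periodic h (2*π) := by
    intro x
    simp only [hh]
    have e1 : (2*(n:ℝ)-1) * (x+2*π) / 2 = (2*(n:ℝ)-1) * x / 2 + ((2*(n:ℤ)-1:ℤ):ℝ) * π := by push_cast; ring
    have e2 : (x+2*π)/2 + γ = (x/2+γ) + ((1:ℤ):ℝ) * π := by push_cast; ring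
    rw [e1, e2, abs_sin_add_nat_pi, abs_sin_add_nat_pi]
  have h1 : JJ n (γ + π / (2*(n:ℝ)-1)) = ∫ x in (0:ℝ)..(2*π), h (x + 2*π/(2*(n:ℝ)-1)) := by
    unfold JJ
    apply intervalIntegral.integral_congr
    intro x _
    simp only [hh]
    have e1 : (2*(n:ℝ)-1) * (x + 2*π/(2*(n:ℝ)-1)) / 2 = (2*(n:ℝ)-1) * x / 2 + ((1:ℤ):ℝ) * π := by
      rw [mul_add, mul_div_cancel₀ _ hN.ne']; push_cast; ring
    have e2 : (x + 2*π/(2*(n:ℝ)-1))/2 + γ = x/2 + (γ + π / (2*(n:ℝ)-1)) := by ring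
    rw [e1, e2, abs_sin_add_nat_pi]
  rw [h1, intervalIntegral.integral_comp_add_right]
  have := hper.intervalIntegral_add_eq (0 + 2*π/(2*(n:ℝ)-1)) 0
  rw [zero_add, zero_add] at *
  rw [add_comm (2*π) _, this]
  rfl

lemma int_abs_sin (t : ℝ) : ∫ x in t..(t+π), |Real.sin x| = 2 := by
  have hper : Function.Periodic (fun x => |Real.sin x|) π := by
    intro x; simp
  rw [hper.intervalIntegral_add_eq t 0, zero_add]
  have : ∫ x in (0:ℝ)..π, |Real.sin x| = ∫ x in (0:ℝ)..π, Real.sin x := by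
    apply intervalIntegral.integral_congr
    intro x hx
    rw [uIcc_of_le Real.pi_pos.le] at hx
    exact abs_of_nonneg (Real.sin_nonneg_of_mem_Icc hx)
  rw [this, integral_sin]; simp; norm_num

lemma int_abs_sinN {n : ℕ} (hn : 1 ≤ n) :
    ∫ x in (0:ℝ)..(2*π), |Real.sin ((2*(n:ℝ)-1) * x / 2)| = 4 := by
  have hN := Npos hn
  have hper : Function.Periodic (fun x => |Real.sin x|) π := by
    intro x; simp
  have e : ∀ x : ℝ, (2*(n:ℝ)-1) * x / 2 = ((2*(n:ℝ)-1)/2) * x := by intro x; ring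
  simp only [e]
  rw [intervalIntegral.integral_comp_mul_left (fun x => |Real.sin x|) (by positivity)]
  have h := hper.intervalIntegral_add_zsmul_eq (2*(n:ℤ)-1) 0 (fun a b => Continuous.intervalIntegrable (by fun_prop) _ _)
  rw [int_abs_sin] at h
  have e2 : (2*(n:ℝ)-1)/2 * (2*π) = 0 + (2*(n:ℤ)-1) • π := by
    rw [zsmul_eq_mul]; push_cast; ring
  rw [mul_zero, e2, h, zsmul_eq_mul, smul_eq_mul]
  push_cast; field_simp; norm_num

lemma JJ_avg {n : ℕ} (hn : 1 ≤ n) : ∫ γ in (0:ℝ)..π, JJ n γ = 8 := by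
  unfold JJ
  rw [MeasureTheory.intervalIntegral_intervalIntegral_swap]
  · have : ∀ x : ℝ, ∫ γ in (0:ℝ)..π, |Real.sin ((2*(n:ℝ)-1) * x / 2)| * |Real.sin (x/2 + γ)| =
        |Real.sin ((2*(n:ℝ)-1) * x / 2)| * 2 := by
      intro x
      rw [intervalIntegral.integral_const_mul,
        intervalIntegral.integral_comp_add_left (fun y => |Real.sin y|), add_zero, int_abs_sin]
    simp only [this]
    rw [intervalIntegral.integral_mul_const, int_abs_sinN hn]; norm_num
  · have hc : Continuous (Function.uncurry fun (γ x : ℝ) =>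
        |Real.sin ((2*(n:ℝ)-1) * x / 2)| * |Real.sin (x/2 + γ)|) := by
      unfold Function.uncurry; fun_prop
    refine (hc.continuousOn.integrableOn_compact
      ((isCompact_uIcc (a := (0:ℝ)) (b := π)).prod (isCompact_uIcc (a := (0:ℝ)) (b := 2*π)))).mono_set
      (Set.prod_mono uIoc_subset_uIcc uIoc_subset_uIcc)

lemma JJ_est {n : ℕ} (hn : 1 ≤ n) (γ : ℝ) : |JJ n γ - 8/π| ≤ 2 * π^2 / n := by
  have hN := Npos hn
  have hn' : (1:ℝ) ≤ n := by exact_mod_cast hn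
  have hpi := Real.pi_pos
  have hc : Continuous (JJ n) := by
    have : LipschitzWith (Real.toNNReal (2*π)) (JJ n) := by
      apply LipschitzWith.of_dist_le_mul
      intro x y
      rw [Real.dist_eq, Real.dist_eq, Real.coe_toNNReal _ (by positivity)]
      exact JJ_lip n x y
    exact this.continuous
  have hb : ∀ γ', |JJ n γ - JJ n γ'| ≤ 2 * π^2 / n := by
    intro γ'
    obtain ⟨y, hy, hyy⟩ := (JJ_per hn).exists_mem_Ico (by positivity) γ' γ
    rw [hyy]
    refine (JJ_lip n γ y).trans ?_
    have h1 : |γ - y| ≤ π / (2*(n:ℝ)-1) := by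
      rw [abs_le]; constructor <;> linarith [hy.1, hy.2, (by positivity : 0 < π / (2*(n:ℝ)-1))]
    have h2 : π / (2*(n:ℝ)-1) ≤ π / n := by gcongr; linarith
    calc 2*π*|γ-y| ≤ 2*π*(π/n) := by gcongr; linarith
      _ = _ := by ring
  have h := intervalIntegral.norm_integral_le_of_norm_le_const (a := 0) (b := π) (C := 2 * π^2 / n)
    (f := fun γ' => JJ n γ - JJ n γ') (fun x _ => hb x)
  rw [intervalIntegral.integral_sub (by simp) (hc.intervalIntegrable _ _), JJ_avg hn] at h
  simp only [intervalIntegral.integral_const, sub_zero, smul_eq_mul, Real.norm_eq_abs] at h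
  have e : JJ n γ - 8/π = (π * JJ n γ - 8) / π := by field_simp
  rw [e, abs_div, abs_of_pos hpi, div_le_iff₀ hpi]
  rw [abs_of_pos hpi] at h
  exact h

/-! ### Kernel decomposition -/

noncomputable def KR (r β t : ℝ) : ℝ := ker1 (fun k : ℕ => (k:ℝ) ^ (-r)) (fun _ => β) t

lemma KR_eq (r β t : ℝ) : KR r β t = ∑' k : ℕ, (((k+1:ℕ):ℝ)) ^ (-r) * Real.cos (((k+1:ℕ):ℝ) * t - π * β / 2) := by
  unfold KR ker1; push_cast; rfl

lemma KR_bd (r : ℝ) (k : ℕ) (c : ℝ) :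
    ‖(((k+1:ℕ):ℝ)) ^ (-r) * Real.cos c‖ ≤ (((k+1:ℕ):ℝ)) ^ (-r) := by
  rw [norm_mul, Real.norm_of_nonneg (by positivity)]
  exact mul_le_of_le_one_right (by positivity) (Real.abs_cos_le_one _)

lemma KR_cont {r : ℝ} (hr : 1 < r) (β : ℝ) : Continuous (KR r β) := by
  have : KR r β = fun t => ∑' k : ℕ, (((k+1:ℕ):ℝ)) ^ (-r) * Real.cos (((k+1:ℕ):ℝ) * t - π * β / 2) :=
    funext (KR_eq r β)
  rw [this]
  exact continuous_tsum (fun k => by fun_prop) (summable_psi r hr) (fun k t => KR_bd r k _)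

lemma KR_per (r β t : ℝ) : KR r β (t + 2*π) = KR r β t := by
  rw [KR_eq, KR_eq]
  congr 1; ext k
  have : ((k+1:ℕ):ℝ) * (t + 2*π) - π * β / 2 = (((k+1:ℕ):ℝ) * t - π * β / 2) + ((k+1:ℕ):ℝ) * (2*π) := by ring
  rw [this, Real.cos_add_nat_mul_two_pi]

lemma KR_bounded {r : ℝ} (hr : 1 < r) (β t : ℝ) : ‖KR r β t‖ ≤ ∑' k : ℕ, (((k+1:ℕ):ℝ)) ^ (-r) := by
  rw [KR_eq]
  exact tsum_of_norm_bounded (summable_psi r hr).hasSum (fun k => KR_bd r k _)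

lemma KR_err {n : ℕ} {r : ℝ} (hr : 1 < r) (β x t : ℝ) :
    HasSum (fun k : ℕ => (((k+1:ℕ):ℝ)) ^ (-r) * eH n (k+1) (((k+1:ℕ):ℝ) * t + π * β / 2) x)
      (KR r β (x - t) - SI n (fun y => KR r β (y - t)) x) := by
  have hs : ∀ y, HasSum (fun k : ℕ => (((k+1:ℕ):ℝ)) ^ (-r) * Real.cos (((k+1:ℕ):ℝ) * y - (((k+1:ℕ):ℝ) * t + π * β / 2)))
      (KR r β (y - t)) := by
    intro y
    rw [KR_eq]
    have e : ∀ k : ℕ, ((k+1:ℕ):ℝ) * y - (((k+1:ℕ):ℝ) * t + π * β / 2) = ((k+1:ℕ):ℝ) * (y - t) - π * β / 2 := by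
      intro k; ring
    simp only [e]
    exact (Summable.of_norm_bounded (summable_psi r hr) (fun k => KR_bd r k _)).hasSum
  have h2 : HasSum (fun k : ℕ => SI n (fun y => (((k+1:ℕ):ℝ)) ^ (-r) * Real.cos (((k+1:ℕ):ℝ) * y - (((k+1:ℕ):ℝ) * t + π * β / 2))) x)
      (SI n (fun y => KR r β (y - t)) x) := by
    unfold SI
    refine HasSum.mul_left _ ?_
    refine hasSum_sum (fun j _ => ?_)
    exact (hs (nodeX n j)).mul_right (DK n (x - nodeX n j))
  have h3 := (hs x).sub h2
  suffices h4 : (fun k : ℕ => (((k+1:ℕ):ℝ)) ^ (-r) * eH n (k+1) (((k+1:ℕ):ℝ) * t + π * β / 2) x) =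
      fun k : ℕ => (((k+1:ℕ):ℝ)) ^ (-r) * Real.cos (((k+1:ℕ):ℝ) * x - (((k+1:ℕ):ℝ) * t + π * β / 2)) -
        SI n (fun y => (((k+1:ℕ):ℝ)) ^ (-r) * Real.cos (((k+1:ℕ):ℝ) * y - (((k+1:ℕ):ℝ) * t + π * β / 2))) x by
    rw [h4]; exact h3
  funext k
  unfold eH
  rw [SI_smul]; ring

lemma KR_main {n : ℕ} (hn : 1 ≤ n) {r : ℝ} (hr : (n:ℝ) + 1 ≤ r) (β x t : ℝ) :
    |(KR r β (x - t) - SI n (fun y => KR r β (y - t)) x) -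
      (n:ℝ) ^ (-r) * (-2 * Real.sin ((2*(n:ℝ)-1) * x / 2) * Real.sin (x/2 - (n * t + π * β / 2)))| ≤
      6 * ((n:ℝ) ^ (-r) * Real.exp (-r / ((n:ℝ)+1))) := by
  have hn' : (1:ℝ) ≤ n := by exact_mod_cast hn
  have h := KR_err (n := n) (r := r) (by linarith) β x t
  have h2 := (hasSum_nat_add_iff' n).2 h
  obtain ⟨m, rfl⟩ : ∃ m, n = m + 1 := ⟨n-1, by omega⟩
  rw [Finset.sum_range_succ, Finset.sum_eq_zero (fun k hk => by
    rw [eH_small hn _ (by have := Finset.mem_range.1 hk; omega), mul_zero]), zero_add, eH_n hn] at h2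
  have hs : Summable (fun k : ℕ => (((k+(m+1)+1:ℕ):ℝ)) ^ (-r)) := by
    have := (summable_nat_add_iff (m+1+1)).2 (Real.summable_nat_rpow (p := -r).2 (by linarith))
    exact this
  have hb := tail_bound hn r hr
  have := tsum_of_norm_bounded (f := fun k : ℕ => (((k+(m+1)+1:ℕ):ℝ)) ^ (-r) *
      eH (m+1) (k+(m+1)+1) (((k+(m+1)+1:ℕ):ℝ) * t + π * β / 2) x) (hs.hasSum.mul_left 2) (by
    intro k
    rw [norm_mul, Real.norm_of_nonneg (by positivity), mul_comm]
    exact mul_le_mul_of_nonneg_right (eH_bound hn _ _ _) (by positivity))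
  rw [h2.tsum_eq] at this
  rw [Real.norm_eq_abs] at this
  linarith

lemma polar (a b : ℝ) : ∃ A γ : ℝ, 0 ≤ A ∧ a = A * Real.cos γ ∧ b = A * Real.sin γ := by
  refine ⟨‖(⟨a, b⟩ : ℂ)‖, Complex.arg ⟨a, b⟩, norm_nonneg _, ?_, ?_⟩
  · rw [Complex.norm_mul_cos_arg]
  · rw [Complex.norm_mul_sin_arg]

lemma conv_cont {r : ℝ} (hr : 1 < r) (β : ℝ) (φ : ℝ → ℝ) (hφ : IntervalIntegrable φ volume 0 (2*π)) :
    Continuous (fun x => ∫ t in (0:ℝ)..(2*π), KR r β (x - t) * φ t) := by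
  have hK := KR_cont hr β
  apply intervalIntegral.continuous_of_dominated_interval
    (bound := fun t => (∑' k : ℕ, (((k+1:ℕ):ℝ)) ^ (-r)) * ‖φ t‖)
  · intro x
    have hc : Continuous (fun t => KR r β (x - t)) := by fun_prop
    exact hc.aestronglyMeasurable.mul hφ.aestronglyMeasurable_restrict_uIoc
  · intro x
    refine Filter.Eventually.of_forall fun t _ => ?_
    rw [norm_mul]
    exact mul_le_mul_of_nonneg_right (KR_bounded hr β _) (norm_nonneg _)
  · exact hφ.norm.const_mul _
  · refine Filter.Eventually.of_forall fun t _ => ?_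
    fun_prop

lemma err_formula {n : ℕ} (hn : 1 ≤ n) {r : ℝ} (hr : (n:ℝ) + 1 ≤ r) (β a₀ : ℝ) (φ f : ℝ → ℝ)
    (hφ : AdmPhi φ)
    (hf : ∀ x, f x = a₀ / 2 + (1/π) * ∫ t in (0:ℝ)..(2*π), KR r β (x - t) * φ t) :
    ∃ A γ : ℝ, 0 ≤ A ∧ A ≤ 1 ∧ (∫ t in (0:ℝ)..(2*π), Real.cos (n * t) * φ t) ≤ A ∧
      ∀ x, |(f x - SI n f x) - (n:ℝ) ^ (-r) * (1/π) *
        (-2 * Real.sin ((2*(n:ℝ)-1) * x / 2) * (A * Real.sin (x/2 + γ)))| ≤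
        (1/π) * (6 * ((n:ℝ) ^ (-r) * Real.exp (-r / ((n:ℝ)+1)))) := by
  have hn' : (1:ℝ) ≤ n := by exact_mod_cast hn
  have hr1 : 1 < r := by linarith
  have hpi := Real.pi_pos
  obtain ⟨-, hint, -, hnorm⟩ := hφ
  have hφI : IntervalIntegrable φ volume 0 (2*π) :=
    (intervalIntegrable_iff_integrableOn_Ioc_of_le (by positivity)).2 hint
  have hmul : ∀ g : ℝ → ℝ, Continuous g → IntervalIntegrable (fun t => g t * φ t) volume 0 (2*π) :=
    fun g hg => hφI.continuousOn_mul hg.continuousOn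
  have hK := KR_cont hr1 β
  -- bounds for integrals against φ
  have hbound : ∀ (g : ℝ → ℝ) (B : ℝ), (∀ t, |g t| ≤ B) → |∫ t in (0:ℝ)..(2*π), g t * φ t| ≤ B := by
    intro g B hg
    have hB : 0 ≤ B := (abs_nonneg _).trans (hg 0)
    have h := intervalIntegral.norm_integral_le_of_norm_le (μ := volume) (a := 0) (b := 2*π)
      (f := fun t => g t * φ t) (g := fun t => B * |φ t|) (by positivity)
      (Filter.Eventually.of_forall fun t _ => by
        rw [norm_mul]; exact mul_le_mul_of_nonneg_right (hg t) (norm_nonneg _)) (hφI.abs.const_mul _)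
    rw [intervalIntegral.integral_const_mul] at h
    exact h.trans (mul_le_of_le_one_right hB hnorm)
  obtain ⟨A, δ, hA, ha, hb⟩ := polar (∫ t in (0:ℝ)..(2*π), Real.cos (n * t) * φ t)
    (∫ t in (0:ℝ)..(2*π), Real.sin (n * t) * φ t)
  have hcomb : ∀ u v : ℝ, ∫ t in (0:ℝ)..(2*π), (u * Real.cos (n*t) + v * Real.sin (n*t)) * φ t =
      u * (A * Real.cos δ) + v * (A * Real.sin δ) := by
    intro u v
    rw [← ha, ← hb, ← intervalIntegral.integral_const_mul, ← intervalIntegral.integral_const_mul,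
      ← intervalIntegral.integral_add ((hmul _ (by fun_prop)).const_mul _) ((hmul _ (by fun_prop)).const_mul _)]
    congr 1; ext t; ring
  refine ⟨A, -(π*β/2) - δ, hA, ?_, ?_, ?_⟩
  · have h1 := hcomb (Real.cos δ) (Real.sin δ)
    have h2 := hbound (fun t => Real.cos δ * Real.cos (n*t) + Real.sin δ * Real.sin (n*t)) 1 (by
      intro t; rw [← Real.cos_sub]; exact Real.abs_cos_le_one _)
    rw [h1] at h2
    have e : Real.cos δ * (A * Real.cos δ) + Real.sin δ * (A * Real.sin δ) = A := by
      linear_combination A * Real.sin_sq_add_cos_sq δ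
    rw [e] at h2
    exact (le_abs_self _).trans h2
  · rw [ha]; exact mul_le_of_le_one_right hA (Real.cos_le_one _)
  · intro x
    have e1 : f x - SI n f x = (1/π) * ∫ t in (0:ℝ)..(2*π),
        (KR r β (x - t) - SI n (fun y => KR r β (y - t)) x) * φ t := by
      have hf' : f = fun x => a₀ / 2 + (1/π) * ∫ t in (0:ℝ)..(2*π), KR r β (x - t) * φ t := funext hf
      rw [hf x, hf', SI_add, SI_const hn, SI_smul]
      have hSI : SI n (fun x => ∫ t in (0:ℝ)..(2*π), KR r β (x - t) * φ t) x =
          ∫ t in (0:ℝ)..(2*π), SI n (fun y => KR r β (y - t)) x * φ t := by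
        unfold SI
        have : ∀ t, (1 / (2 * (n:ℝ) - 1) * ∑ j ∈ Finset.range (2*n-1), KR r β (nodeX n j - t) * DK n (x - nodeX n j)) * φ t
          = (1 / (2 * (n:ℝ) - 1)) * ∑ j ∈ Finset.range (2*n-1), (KR r β (nodeX n j - t) * φ t) * DK n (x - nodeX n j) := by
          intro t; rw [mul_assoc, Finset.sum_mul]; congr 1
          apply Finset.sum_congr rfl; intros; ring
        simp only [this]
        rw [intervalIntegral.integral_const_mul, intervalIntegral.integral_finsetSum]
        · simp only [intervalIntegral.integral_mul_const]
        · intro j _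
          exact (hmul (fun t => KR r β (nodeX n j - t)) (by fun_prop)).mul_const _
      have hSc : Continuous (fun t => SI n (fun y => KR r β (y - t)) x) := by
        unfold SI; fun_prop
      simp only [sub_mul]
      rw [hSI, intervalIntegral.integral_sub (hmul (fun t => KR r β (x - t)) (by fun_prop)) (hmul _ hSc)]
      ring
    have hSc : Continuous (fun t => SI n (fun y => KR r β (y - t)) x) := by
      unfold SI; fun_prop
    have hkey := hbound (fun t => (KR r β (x - t) - SI n (fun y => KR r β (y - t)) x) -
      (n:ℝ) ^ (-r) * (-2 * Real.sin ((2*(n:ℝ)-1) * x / 2) * Real.sin (x/2 - (n * t + π * β / 2)))) _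
      (fun t => KR_main hn hr β x t)
    simp only [sub_mul _ _ (φ _)] at hkey
    have e2 : ∫ t in (0:ℝ)..(2*π), (n:ℝ) ^ (-r) * (-2 * Real.sin ((2*(n:ℝ)-1) * x / 2) * Real.sin (x/2 - (n * t + π * β / 2))) * φ t
        = (n:ℝ) ^ (-r) * (-2 * Real.sin ((2*(n:ℝ)-1) * x / 2) * (A * Real.sin (x/2 + (-(π*β/2) - δ)))) := by
      have e3 : ∀ t, (n:ℝ) ^ (-r) * (-2 * Real.sin ((2*(n:ℝ)-1) * x / 2) * Real.sin (x/2 - (n * t + π * β / 2))) * φ t =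
        ((n:ℝ) ^ (-r) * (-2 * Real.sin ((2*(n:ℝ)-1) * x / 2))) *
          ((Real.sin (x/2 - π*β/2) * Real.cos (n*t) + (-Real.cos (x/2 - π*β/2)) * Real.sin (n*t)) * φ t) := by
        intro t
        have : x/2 - (n * t + π * β / 2) = (x/2 - π*β/2) - n*t := by ring
        rw [this, Real.sin_sub (x/2 - π*β/2)]; ring
      simp only [e3]
      rw [intervalIntegral.integral_const_mul, hcomb]
      have : x/2 + (-(π*β/2) - δ) = (x/2 - π*β/2) - δ := by ring
      rw [this, Real.sin_sub (x/2 - π*β/2)]; ring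
    have hI1 : IntervalIntegrable (fun t => KR r β (x - t) * φ t - SI n (fun y => KR r β (y - t)) x * φ t) volume 0 (2*π) :=
      (hmul (fun t => KR r β (x - t)) (by fun_prop)).sub (hmul _ hSc)
    rw [intervalIntegral.integral_sub hI1 (hmul (fun t => (n:ℝ) ^ (-r) * (-2 * Real.sin ((2*(n:ℝ)-1) * x / 2) * Real.sin (x/2 - (n * t + π * β / 2)))) (by fun_prop)), e2] at hkey
    rw [e1]
    simp only [sub_mul _ _ (φ _)]
    have e4 : ∀ I M : ℝ, 1/π * I - (n:ℝ) ^ (-r) * (1/π) * M = (1/π) * (I - (n:ℝ) ^ (-r) * M) := by intros; ring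
    rw [e4, abs_mul, abs_of_pos (by positivity : 0 < 1/π)]
    exact mul_le_mul_of_nonneg_left hkey (by positivity)

/-! ### Extremal function and conclusion -/

lemma LpNorm_one (g : ℝ → ℝ) (hg : Continuous g) : LpNormPer 1 g = ∫ x in (0:ℝ)..(2*π), |g x| := by
  unfold LpNormPer
  rw [eLpNorm_one_eq_lintegral_enorm, intervalIntegral.integral_of_le (by positivity),
    ← integral_norm_eq_lintegral_enorm hg.aestronglyMeasurable]
  rfl

lemma norm_est {n : ℕ} (hn : 1 ≤ n) {r : ℝ} (hr : (n:ℝ) + 1 ≤ r) (β a₀ : ℝ) (φ f : ℝ → ℝ)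
    (hφ : AdmPhi φ)
    (hf : ∀ x, f x = a₀ / 2 + (1/π) * ∫ t in (0:ℝ)..(2*π), KR r β (x - t) * φ t) :
    ∃ A : ℝ, 0 ≤ A ∧ A ≤ 1 ∧ (∫ t in (0:ℝ)..(2*π), Real.cos (n * t) * φ t) ≤ A ∧
      |(n:ℝ) ^ r * LpNormPer 1 (fun x => f x - SI n f x) - A * (16 / π^2)| ≤
        4 * π / n + 12 * Real.exp (-r / ((n:ℝ)+1)) := by
  obtain ⟨A, γ, hA0, hA1, hA2, hE⟩ := err_formula hn hr β a₀ φ f hφ hf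
  refine ⟨A, hA0, hA1, hA2, ?_⟩
  have hn' : (1:ℝ) ≤ n := by exact_mod_cast hn
  have hpi := Real.pi_pos
  have hφI : IntervalIntegrable φ volume 0 (2*π) :=
    (intervalIntegrable_iff_integrableOn_Ioc_of_le (by positivity)).2 hφ.2.1
  have hfc : Continuous f := by
    rw [show f = _ from funext hf]
    exact continuous_const.add (continuous_const.mul (conv_cont (by linarith) β φ hφI))
  have hgc : Continuous (fun x => f x - SI n f x) := by
    refine hfc.sub ?_
    unfold SI DK; fun_prop
  rw [LpNorm_one _ hgc]
  set e := Real.exp (-r / ((n:ℝ)+1)) with he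
  set P := (n:ℝ) ^ (-r) with hP
  have hP0 : 0 < P := by positivity
  have hPr : (n:ℝ) ^ r * P = 1 := by rw [hP, ← Real.rpow_add (by positivity)]; simp
  have hR0 : 0 < (n:ℝ) ^ r := by positivity
  have hJ : ∫ x in (0:ℝ)..(2*π), |P * (1/π) * (-2 * Real.sin ((2*(n:ℝ)-1) * x / 2) * (A * Real.sin (x/2 + γ)))|
      = P * (2 * A / π) * JJ n γ := by
    unfold JJ
    rw [← intervalIntegral.integral_const_mul]
    congr 1; ext x
    rw [abs_mul, abs_mul, abs_mul, abs_mul, abs_mul, abs_of_pos hP0, abs_of_nonneg hA0,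
      abs_of_pos (by positivity : 0 < 1/π)]
    norm_num; ring
  have hd : |(∫ x in (0:ℝ)..(2*π), |f x - SI n f x|) - P * (2 * A / π) * JJ n γ| ≤ 12 * (P * e) := by
    rw [← hJ, ← intervalIntegral.integral_sub (hgc.abs.intervalIntegrable _ _)
      (Continuous.intervalIntegrable (by fun_prop) _ _)]
    have h := intervalIntegral.norm_integral_le_of_norm_le_const (a := 0) (b := 2*π)
      (C := (1/π) * (6 * (P * e)))
      (f := fun x => |f x - SI n f x| - |P * (1/π) * (-2 * Real.sin ((2*(n:ℝ)-1) * x / 2) * (A * Real.sin (x/2 + γ)))|)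
      (fun x _ => (abs_abs_sub_abs_le_abs_sub _ _).trans (hE x))
    rw [Real.norm_eq_abs, sub_zero, abs_of_pos (by positivity : (0:ℝ) < 2*π)] at h
    refine h.trans (le_of_eq ?_)
    field_simp; ring
  have hJe := JJ_est hn γ
  have h1 : |(n:ℝ) ^ r * (∫ x in (0:ℝ)..(2*π), |f x - SI n f x|) - (2 * A / π) * JJ n γ| ≤ 12 * e := by
    have : (n:ℝ) ^ r * (∫ x in (0:ℝ)..(2*π), |f x - SI n f x|) - (2 * A / π) * JJ n γ =
        (n:ℝ) ^ r * ((∫ x in (0:ℝ)..(2*π), |f x - SI n f x|) - P * (2 * A / π) * JJ n γ) := by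
      linear_combination (2 * A / π * JJ n γ) * hPr
    rw [this, abs_mul, abs_of_pos hR0]
    calc _ ≤ (n:ℝ) ^ r * (12 * (P * e)) := by gcongr
      _ = _ := by linear_combination (12 * e) * hPr
  have h2 : |(2 * A / π) * JJ n γ - A * (16 / π^2)| ≤ 4 * π / n := by
    have : (2 * A / π) * JJ n γ - A * (16 / π^2) = (2 * A / π) * (JJ n γ - 8/π) := by
      field_simp; ring
    rw [this, abs_mul, abs_of_nonneg (by positivity)]
    calc _ ≤ (2 * 1 / π) * (2 * π^2 / n) := by gcongr
      _ = _ := by field_simp; ring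
  have := abs_sub_le ((n:ℝ) ^ r * (∫ x in (0:ℝ)..(2*π), |f x - SI n f x|)) ((2 * A / π) * JJ n γ) (A * (16 / π^2))
  linarith

/-- odd threshold function -/
noncomputable def hT (s x : ℝ) : ℝ := max (x - s) 0 - max (-x - s) 0

lemma hT_abs {s : ℝ} (hs : 0 ≤ s) (x : ℝ) : s * |hT s x| ≤ x * hT s x := by
  unfold hT
  rcases le_total x s with h1 | h1 <;> rcases le_total (-x) s with h2 | h2
  · rw [max_eq_right (by linarith), max_eq_right (by linarith)]; simp
  · rw [max_eq_right (by linarith), max_eq_left (by linarith), abs_of_nonpos (by linarith)]; nlinarith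
  · rw [max_eq_left (by linarith), max_eq_right (by linarith), abs_of_nonneg (by linarith)]; nlinarith
  · rw [max_eq_left (by linarith), max_eq_left (by linarith)]
    have : x = 0 := by linarith
    have : s = 0 := by linarith
    simp [*]

lemma exists_phi {n : ℕ} (hn : 1 ≤ n) : ∃ φ : ℝ → ℝ, AdmPhi φ ∧
    1 - 1/((n:ℝ)+1) ≤ ∫ t in (0:ℝ)..(2*π), Real.cos (n * t) * φ t := by
  have hn' : (1:ℝ) ≤ n := by exact_mod_cast hn
  have hpi := Real.pi_pos
  set s : ℝ := 1 - 1/((n:ℝ)+1) with hs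
  have hlt : (0:ℝ) < 1/((n:ℝ)+1) := by positivity
  have hle : 1/((n:ℝ)+1) ≤ 1 := by rw [div_le_one (by positivity)]; linarith
  have hs0 : 0 ≤ s := by linarith
  set g : ℝ → ℝ := fun t => hT s (Real.cos (n * t)) with hg
  have hgc : Continuous g := by simp only [hg]; unfold hT; fun_prop
  have hper : Function.Periodic g (2*π) := by
    intro t
    simp only [hg, mul_add]
    rw [Real.cos_add_nat_mul_two_pi]
  have hanti : ∀ t, g (t + π/n) = - g t := by
    intro t
    have : (n:ℝ) * (t + π/n) = n*t + π := by field_simp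
    simp only [hg]
    rw [this, Real.cos_add_pi]; unfold hT; rw [neg_neg]; ring
  have h0 : ∫ t in (0:ℝ)..(2*π), g t = 0 := by
    have h1 : ∫ t in (0:ℝ)..(2*π), g (t + π/n) = ∫ t in (0:ℝ)..(2*π), g t := by
      rw [intervalIntegral.integral_comp_add_right]
      have := hper.intervalIntegral_add_eq (0 + π/n) 0
      rw [zero_add, zero_add] at *
      rw [add_comm (2*π) _, this]
    simp only [hanti, intervalIntegral.integral_neg] at h1
    linarith
  set I := ∫ t in (0:ℝ)..(2*π), |g t| with hI
  have hIpos : 0 < I := by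
    apply intervalIntegral.integral_pos (by positivity) hgc.abs.continuousOn (fun _ _ => abs_nonneg _)
    refine ⟨0, ⟨le_rfl, by positivity⟩, ?_⟩
    simp only [hg, mul_zero, Real.cos_zero]
    unfold hT
    rw [max_eq_left (by linarith), max_eq_right (by linarith)]
    rw [abs_pos]; linarith
  refine ⟨fun t => I⁻¹ * g t, ⟨?_, ?_, ?_, ?_⟩, ?_⟩
  · intro t; show I⁻¹ * g (t + 2*π) = I⁻¹ * g t; rw [hper t]
  · exact ((continuous_const.mul hgc).integrableOn_Icc (a := 0) (b := 2*π)).mono_set Ioc_subset_Icc_self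
  · rw [intervalIntegral.integral_const_mul, h0, mul_zero]
  · simp only [abs_mul, abs_of_pos (inv_pos.2 hIpos)]
    rw [intervalIntegral.integral_const_mul, ← hI, inv_mul_cancel₀ hIpos.ne']
  · have e : ∀ t, Real.cos (n*t) * (I⁻¹ * g t) = I⁻¹ * (Real.cos (n*t) * g t) := by intro t; ring
    simp only [e]
    rw [intervalIntegral.integral_const_mul, inv_mul_eq_div, le_div_iff₀ hIpos, hI,
      ← intervalIntegral.integral_const_mul]
    apply intervalIntegral.integral_mono (by positivity)
      ((hgc.abs.const_mul s).intervalIntegrable _ _) (Continuous.intervalIntegrable (by fun_prop) _ _)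
    intro t
    exact hT_abs hs0 _

/-- **Estimate (54').** For constant `β̄ = β` and `r ≥ n+1`:
`|n^r Ẽ_n(W^r_{β,1})_{L_1} − 16/π²| ≤ C(1/n + e^{−r/(n+1)})`. -/
theorem statement6 :
    ∃ C : ℝ, 0 < C ∧ ∀ (β : ℝ) (n : ℕ), 1 ≤ n → ∀ (r : ℝ), (n:ℝ) + 1 ≤ r →
      |(n:ℝ) ^ r * interpErr 1 n (ClassC (fun k : ℕ => (k:ℝ) ^ (-r)) (fun _ => β)) -
          16 / π ^ 2| ≤
        C * (1/n + Real.exp (-r / ((n:ℝ)+1))) := by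
  refine ⟨40, by norm_num, ?_⟩
  intro β n hn r hr
  have hn' : (1:ℝ) ≤ n := by exact_mod_cast hn
  have hpi := Real.pi_pos
  have hpi4 : π < 4 := Real.pi_lt_four
  have hpi3 : 3 < π := Real.pi_gt_three
  set S := { e : ℝ | ∃ f ∈ ClassC (fun k : ℕ => (k:ℝ) ^ (-r)) (fun _ => β), ∃ T : ℝ → ℝ,
    InterpolatesAt n T f ∧ e = LpNormPer 1 (fun x => f x - T x) } with hS
  set e := Real.exp (-r / ((n:ℝ)+1)) with he
  have he0 : 0 < e := Real.exp_pos _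
  set P := (n:ℝ) ^ r with hP
  have hP0 : 0 < P := by positivity
  have hq0 : (0:ℝ) < 16 / π^2 := by positivity
  have hq : 16 / π^2 ≤ 2 := by rw [div_le_iff₀ (by positivity)]; nlinarith
  have hinv : (0:ℝ) < 1/n := by positivity
  have h4 : 4 * π / n ≤ 16 * (1/n) := by
    rw [mul_one_div]; gcongr; linarith
  have hub : ∀ y ∈ S, y ≤ (16 / π^2 + (4 * π / n + 12 * e)) / P := by
    rintro y ⟨f, ⟨a₀, φ, hφ, hf⟩, T, hT, rfl⟩
    have hTe : (fun x => f x - T x) = fun x => f x - SI n f x := by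
      ext x; rw [SI_unique hn T f hT x]
    rw [hTe, le_div_iff₀ hP0]
    obtain ⟨A, hA0, hA1, -, hA⟩ := norm_est hn hr β a₀ φ f hφ hf
    have := (abs_le.1 hA).2
    have : A * (16 / π^2) ≤ 1 * (16 / π^2) := by gcongr
    linarith
  obtain ⟨φ, hφ, hφn⟩ := exists_phi hn
  set f : ℝ → ℝ := fun x => 0 / 2 + (1/π) * ∫ t in (0:ℝ)..(2*π), KR r β (x - t) * φ t with hf
  have hfper : ∀ x, f (x + 2*π) = f x := by
    intro x
    simp only [hf]
    have : ∀ t, KR r β (x + 2*π - t) = KR r β (x - t) := by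
      intro t; rw [← KR_per r β (x - t)]; congr 1; ring
    simp only [this]
  have hmem : LpNormPer 1 (fun x => f x - SI n f x) ∈ S :=
    ⟨f, ⟨0, φ, hφ, fun x => rfl⟩, SI n f, ⟨SI_trig f, fun k => SI_interp hn f hfper k⟩, rfl⟩
  have hlow := le_csSup ⟨_, hub⟩ hmem
  have hup := csSup_le ⟨_, hmem⟩ hub
  rw [le_div_iff₀ hP0] at hup
  obtain ⟨A, hA0, hA1, hA2, hA⟩ := norm_est hn hr β 0 φ f hφ (fun x => rfl)
  have hA' := (abs_le.1 hA).1
  have hA3 : 1 - 1/(n:ℝ) ≤ A := by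
    have : 1/((n:ℝ)+1) ≤ 1/n := by gcongr; linarith
    linarith
  have h5 : (1 - 1/(n:ℝ)) * (16 / π^2) ≤ A * (16 / π^2) := by gcongr
  have h6 : P * LpNormPer 1 (fun x => f x - SI n f x) ≤ P * sSup S := by gcongr
  have h7 : 1/(n:ℝ) * (16 / π^2) ≤ 1/(n:ℝ) * 2 := by gcongr
  have hE : interpErr 1 n (ClassC (fun k : ℕ => (k:ℝ) ^ (-r)) (fun _ => β)) = sSup S := rfl
  rw [hE, abs_le]
  constructor <;> nlinarith
end
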